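/- arXiv:2002.06265 — 2 statements merged into one kernel-verified Lean document; each statement's English description precedes it below -/
import Mathlib

section
/- Let S be a string with z LZ77-factors and let q ≥ 3 be a natural number. Then there are at most 6·(1 + 3q/log₂q)·(log₂|S|)·(z+1)·(z+2) pairwise substantially different maximal pairs of S whose corresponding maximal repeat is not a fractional power with exponent ≥ 2q. In particular (q = 3), there are at most 41·(log₂|S|)·(z+1)·(z+2) pairwise substantially different maximal pairs whose corresponding maximal repeat is not a fractional power with exponent ≥ 6. -/
variable {α : Type*}

/-- Character at 1-based position `i` of `S`; the sentinel `dollar` outside `[1, |S|]`,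
in particular `S[0] = $` and `S[|S|+1] = $`. -/
def chr (dollar : α) (S : List α) (i : ℕ) : α :=
  if h : 1 ≤ i ∧ i ≤ S.length then S.get ⟨i - 1, by omega⟩ else dollar

/-- The substring `S[i..j]` (as a list), using the sentinel convention. -/
def substr (dollar : α) (S : List α) (i j : ℕ) : List α :=
  (List.range (j + 1 - i)).map (fun k => chr dollar S (i + k))

/-- `Δ` is a period of `T`: `Δ ≥ 1` and characters at distance `Δ` coincide. -/
def IsPeriodOf (Δ : ℕ) (T : List α) : Prop :=
  1 ≤ Δ ∧ ∀ (k : ℕ) (h : k + Δ < T.length), T.get ⟨k, by omega⟩ = T.get ⟨k + Δ, h⟩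

/-- The minimal period length of `T`. -/
noncomputable def minPeriod (T : List α) : ℕ := sInf {Δ | IsPeriodOf Δ T}

/-- `T` is a fractional power with exponent ≥ `q`: its minimal period `Δ` satisfies `|T| ≥ q·Δ`. -/
def IsFracPowGe (q : ℕ) (T : List α) : Prop := q * minPeriod T ≤ T.length

/-- `(n, m, l)` is a maximal pair of `S` (`l ≥ 1`, both occurrences inside `S`,
equal as strings, different preceding characters, different succeeding characters). -/
def IsMaximalPair (dollar : α) (S : List α) (n m l : ℕ) : Prop :=
  1 ≤ l ∧ 1 ≤ n ∧ 1 ≤ m ∧ n + l - 1 ≤ S.length ∧ m + l - 1 ≤ S.length ∧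
  (∀ k < l, chr dollar S (n + k) = chr dollar S (m + k)) ∧
  chr dollar S (n - 1) ≠ chr dollar S (m - 1) ∧
  chr dollar S (n + l) ≠ chr dollar S (m + l)

/-- The two maximal pairs `p`, `p'` of `S` are copies of each other: the unordered pairs of
padded occurrence strings `{S[n-1..n+l], S[m-1..m+l]}` coincide. -/
def CopiesMP (dollar : α) (S : List α) (p p' : ℕ × ℕ × ℕ) : Prop :=
  ({substr dollar S (p.1 - 1) (p.1 + p.2.2), substr dollar S (p.2.1 - 1) (p.2.1 + p.2.2)} :
      Set (List α)) =
  ({substr dollar S (p'.1 - 1) (p'.1 + p'.2.2), substr dollar S (p'.2.1 - 1) (p'.2.1 + p'.2.2)} :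
      Set (List α))

/-- `P` occurs at least twice in `T` (occurrences may overlap). -/
def OccursTwiceIn (P T : List α) : Prop :=
  ∃ p₁ p₂ : ℕ, p₁ < p₂ ∧ p₂ + P.length ≤ T.length ∧ P <+: T.drop p₁ ∧ P <+: T.drop p₂

/-- `L` is the (self-referential) LZ77-decomposition of `S`: each factor is either a fresh
single character, or the longest prefix of the remaining suffix occurring at least twice in
the text up to (and including) this factor. -/
def IsLZ77 (S : List α) (L : List (List α)) : Prop :=
  S = L.flatten ∧
  ∀ (i : ℕ) (h : i < L.length),
    L.get ⟨i, h⟩ ≠ [] ∧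
    ((∃ c : α, L.get ⟨i, h⟩ = [c] ∧ c ∉ (L.take i).flatten) ∨
     (OccursTwiceIn (L.get ⟨i, h⟩) ((L.take i).flatten ++ L.get ⟨i, h⟩) ∧
      ∀ F' : List α, F' <+: S.drop ((L.take i).flatten).length →
        OccursTwiceIn F' ((L.take i).flatten ++ F') → F'.length ≤ (L.get ⟨i, h⟩).length))

/-- The cyclic rotation of `S$` by `k`. -/
def rot (dollar : α) (S : List α) (k : ℕ) : List α :=
  (S ++ [dollar]).drop k ++ (S ++ [dollar]).take k

/-- `π` enumerates (1-based, for `i = 1, …, |S|+1`) the cyclic rotations of `S$`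
in lexicographic order; the BWT of `S` is then `i ↦ S[π i]`. -/
def IsBWTPerm [LinearOrder α] (dollar : α) (S : List α) (π : ℕ → ℕ) : Prop :=
  (∀ i, 1 ≤ i → i ≤ S.length + 1 → π i ≤ S.length) ∧
  (∀ i j, 1 ≤ i → i < j → j ≤ S.length + 1 →
    List.Lex (· < ·) (rot dollar S (π i)) (rot dollar S (π j)))

/-- Number of occurrences of `P` in `T`. -/
def occCount [DecidableEq α] (P T : List α) : ℕ :=
  ((Finset.range (T.length + 1)).filter
    (fun p => p + P.length ≤ T.length ∧ P <+: T.drop p)).card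

/-- `P` is a maximal repeat of `S`: nonempty, occurs at least twice, and every one-character
extension occurs strictly fewer times. -/
def IsMaximalRepeat [DecidableEq α] (S P : List α) : Prop :=
  P ≠ [] ∧ 2 ≤ occCount P S ∧
  (∀ c : α, occCount (c :: P) S < occCount P S) ∧
  (∀ c : α, occCount (P ++ [c]) S < occCount P S)

/-- `u` is primitive: not expressible as `v^k` with `k ≥ 2`. -/
def Primitive (u : List α) : Prop :=
  ∀ (v : List α) (k : ℕ), 2 ≤ k → u ≠ (List.replicate k v).flatten

/-- `(l', r')` is the maximal `Δ`-periodic extension of the occurrence `S[l..r]`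
(the padded maximal `Δ`-periodic extension is then `(l'-1, r'+1)`). -/
def IsMaxPerExt (dollar : α) (S : List α) (Δ l r l' r' : ℕ) : Prop :=
  1 ≤ l' ∧ l' ≤ l ∧ l ≤ r ∧ r ≤ r' ∧ r' ≤ S.length ∧ Δ ≤ r + 1 - l ∧
  IsPeriodOf Δ (substr dollar S l' r') ∧
  ¬ IsPeriodOf Δ (substr dollar S (l' - 1) r') ∧
  ¬ IsPeriodOf Δ (substr dollar S l' (r' + 1))

/-- The maximal periodic extension (w.r.t. the minimal period length) of the occurrence
`S[l..r]` adds at most one period length of additional characters. -/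
def ShortExt (dollar : α) (S : List α) (l r : ℕ) : Prop :=
  ∃ l' r', IsMaxPerExt dollar S (minPeriod (substr dollar S l r)) l r l' r' ∧
    (l - l') + (r' - r) ≤ minPeriod (substr dollar S l r)

/-- `P` is a period of the first `k` letters of the infinite word `v`. -/
def PrefixPeriod (v : ℕ → α) (k P : ℕ) : Prop := ∀ i, i + P < k → v i = v (i + P)

/-- The least positive period of the first `k` letters of `v`. -/
noncomputable def minPrefixPeriod (v : ℕ → α) (k : ℕ) : ℕ :=
  sInf {P | 1 ≤ P ∧ PrefixPeriod v k P}

lemma PrefixPeriod.mono {v : ℕ → α} {k k' P : ℕ} (h : PrefixPeriod v k' P) (hk : k ≤ k') :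
    PrefixPeriod v k P := fun i hi => h i (by omega)

lemma minPrefixPeriod_spec (v : ℕ → α) (k : ℕ) :
    1 ≤ minPrefixPeriod v k ∧ PrefixPeriod v k (minPrefixPeriod v k) :=
  Nat.sInf_mem (s := {P | 1 ≤ P ∧ PrefixPeriod v k P})
    ⟨k + 1, by omega, fun i hi => by omega⟩

lemma minPrefixPeriod_le {v : ℕ → α} {k P : ℕ} (hP : 1 ≤ P) (h : PrefixPeriod v k P) :
    minPrefixPeriod v k ≤ P := Nat.sInf_le ⟨hP, h⟩

lemma minPrefixPeriod_le_self (v : ℕ → α) {k : ℕ} (hk : 1 ≤ k) : minPrefixPeriod v k ≤ k :=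
  minPrefixPeriod_le hk fun i hi => by omega

lemma minPrefixPeriod_mono (v : ℕ → α) {k k' : ℕ} (h : k ≤ k') :
    minPrefixPeriod v k ≤ minPrefixPeriod v k' :=
  minPrefixPeriod_le (minPrefixPeriod_spec v k').1 ((minPrefixPeriod_spec v k').2.mono h)

lemma PrefixPeriod.sub {v : ℕ → α} {k P Q : ℕ} (hP : PrefixPeriod v k P)
    (hQ : PrefixPeriod v k Q) (hPQ : P ≤ Q) (hk : P + Q ≤ k) : PrefixPeriod v k (Q - P) := by
  intro i hi
  by_cases h : P ≤ i
  · have h1 := hP (i - P) (by omega)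
    have h2 := hQ (i - P) (by omega)
    rw [show i - P + P = i by omega] at h1
    rw [show i - P + Q = i + (Q - P) by omega] at h2
    rw [← h1, h2]
  · have h1 := hQ i (by omega)
    have h2 := hP (i + (Q - P)) (by omega)
    rw [show i + (Q - P) + P = i + Q by omega] at h2
    rw [h1, h2]

lemma minPrefixPeriod_dvd {v : ℕ → α} {k : ℕ} (Q : ℕ) (hQ : PrefixPeriod v k Q)
    (hk : minPrefixPeriod v k + Q ≤ k) : minPrefixPeriod v k ∣ Q := by
  induction Q using Nat.strong_induction_on with
  | _ Q ih =>
    obtain ⟨h1, h2⟩ := minPrefixPeriod_spec v k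
    rcases Nat.eq_zero_or_pos Q with rfl | hpos
    · exact dvd_zero _
    · have hle := minPrefixPeriod_le hpos hQ
      have := ih (Q - minPrefixPeriod v k) (by omega) (h2.sub hQ hle hk) (by omega)
      exact (Nat.dvd_sub_iff_left hle dvd_rfl).1 this

lemma PrefixPeriod.extend {v : ℕ → α} {t k P Q : ℕ} (hP : PrefixPeriod v t P)
    (hQ : PrefixPeriod v k Q) (hQ0 : 1 ≤ Q) (ht : P + Q ≤ t) : PrefixPeriod v k P := by
  intro i
  induction i using Nat.strong_induction_on with
  | _ i ih =>
    intro hi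
    by_cases h : i + P < t
    · exact hP i h
    · have h1 := hQ (i - Q) (by omega)
      have h2 := hQ (i - Q + P) (by omega)
      have h3 := ih (i - Q) (by omega) (by omega)
      rw [show i - Q + Q = i by omega] at h1
      rw [show i - Q + P + Q = i + P by omega] at h2
      rw [← h1, h3, h2]

lemma card_sub_one_mul_le {G : Finset ℕ} {a t P : ℕ} (hat : a ≤ t)
    (hG : ∀ k ∈ G, a ≤ k ∧ k ≤ t ∧ P ∣ k - a) : (G.card - 1) * P ≤ t - a := by
  have : G.card ≤ (Finset.range ((t - a) / P + 1)).card := by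
    apply Finset.card_le_card_of_injOn (fun k => (k - a) / P)
    · intro k hk
      obtain ⟨h1, h2, -⟩ := hG k hk
      have := Nat.div_le_div_right (c := P) (show k - a ≤ t - a by omega)
      simp only [Finset.coe_range, Set.mem_Iio]
      omega
    · intro k hk k' hk' h
      obtain ⟨h1, -, h3⟩ := hG k hk
      obtain ⟨h1', -, h3'⟩ := hG k' hk'
      have e := Nat.div_mul_cancel h3
      have e' := Nat.div_mul_cancel h3'
      simp only at h
      rw [h] at e
      omega
  rw [Finset.card_range] at this
  calc (G.card - 1) * P ≤ (t - a) / P * P := Nat.mul_le_mul_right _ (Nat.sub_le_of_le_add this)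
    _ ≤ t - a := Nat.div_mul_le_self _ _

/-- Borders of a common word with the same least period differ by multiples of it. -/
lemma minPrefixPeriod_dvd_sub {v : ℕ → α} {k k' : ℕ} (hk : 1 ≤ k) (hkk : k ≤ k')
    (hper : PrefixPeriod v k' (k' - k)) (h : minPrefixPeriod v k' = minPrefixPeriod v k) :
    minPrefixPeriod v k ∣ k' - k := by
  rw [← h]
  apply minPrefixPeriod_dvd _ hper
  have := minPrefixPeriod_le_self v hk
  omega

lemma two_le_logb_three_halves : 2 ≤ 3.5 * Real.logb 2 1.5 := by
  have h : (4 : ℝ) ≤ 7 * Real.logb 2 1.5 := by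
    have h1 : (7 : ℝ) * Real.logb 2 1.5 = Real.logb 2 (1.5 ^ 7) := by
      rw [Real.logb_pow]; norm_num
    have h2 : (4 : ℝ) = Real.logb 2 (2 ^ 4) := by
      rw [Real.logb_pow, Real.logb_self_eq_one (by norm_num)]; norm_num
    rw [h1, h2]
    exact Real.logb_le_logb_of_le (by norm_num) (by norm_num) (by norm_num)
  linarith

lemma card_le_card_group_add {v : ℕ → α} {r : ℕ} {β : ℝ} (hβ0 : 0 ≤ β)
    (hβ : ∀ h : ℕ, h ≤ r → ∀ y : ℝ, 1 ≤ y → (h : ℝ) ≤ y → (h : ℝ) ≤ 1 + β * Real.logb 2 y)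
    (K : Finset ℕ) (hpos : ∀ k ∈ K, 1 ≤ k)
    (hper : ∀ k ∈ K, ∀ k' ∈ K, k < k' → PrefixPeriod v k' (k' - k))
    (hG : ∀ G ⊆ K, ∀ P, (∀ k ∈ G, minPrefixPeriod v k = P) → G.card ≤ r + 1)
    (a : ℕ) (ha : a ∈ K) (hmin : ∀ k ∈ K, minPrefixPeriod v k = minPrefixPeriod v a → a ≤ k)
    (hmax : ∀ k ∈ K, minPrefixPeriod v k ≤ minPrefixPeriod v a) :
    (K.card : ℝ) ≤ (K.filter (fun k => minPrefixPeriod v k = minPrefixPeriod v a)).card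
      + 3.5 * Real.logb 2 a + β * Real.logb 2 (minPrefixPeriod v a) := by
  induction K using Finset.strongInduction generalizing a with
  | H K ih =>
    have hlog : ∀ n : ℕ, 1 ≤ n → 0 ≤ Real.logb 2 (n : ℝ) := fun n hn =>
      Real.logb_nonneg (by norm_num) (by exact_mod_cast hn)
    have hp1 : ∀ k, 1 ≤ minPrefixPeriod v k := fun k => (minPrefixPeriod_spec v k).1
    have ha1 := hpos a ha
    have hsplit := Finset.card_filter_add_card_filter_not (s := K)
      (fun k => minPrefixPeriod v k = minPrefixPeriod v a)
    set G := K.filter (fun k => minPrefixPeriod v k = minPrefixPeriod v a)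
    set K' := K.filter (fun k => ¬ minPrefixPeriod v k = minPrefixPeriod v a)
    have hsplitR : (K.card : ℝ) = G.card + K'.card := by exact_mod_cast hsplit.symm
    rcases K'.eq_empty_or_nonempty with he | hne
    · rw [he, Finset.card_empty] at hsplitR
      have := hlog a ha1
      have := mul_nonneg hβ0 (hlog _ (hp1 a))
      push_cast at hsplitR
      linarith
    have hsub : K' ⊆ K := Finset.filter_subset _ _
    set t := K'.max' hne
    have ht : t ∈ K' := K'.max'_mem hne
    have hK'p : ∀ k ∈ K', minPrefixPeriod v k < minPrefixPeriod v a := fun k hk =>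
      lt_of_le_of_ne (hmax k (hsub hk)) (Finset.mem_filter.1 hk).2
    set G' := K'.filter (fun k => minPrefixPeriod v k = minPrefixPeriod v t)
    have hneG : G'.Nonempty := ⟨t, Finset.mem_filter.2 ⟨ht, rfl⟩⟩
    set a' := G'.min' hneG
    have ha' : a' ∈ G' := G'.min'_mem hneG
    have ha'K : a' ∈ K' := (Finset.mem_filter.1 ha').1
    have hpa' : minPrefixPeriod v a' = minPrefixPeriod v t := (Finset.mem_filter.1 ha').2
    have hlt : ∀ k ∈ K', k ≤ t := fun k hk => K'.le_max' k hk
    have hge : ∀ k ∈ G', a' ≤ k := fun k hk => G'.min'_le k hk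
    have hss : K' ⊂ K := Finset.ssubset_iff_subset_ne.2 ⟨hsub, fun h => by
      have := hK'p a (h ▸ ha); omega⟩
    have IH := ih K' hss (fun k hk => hpos k (hsub hk))
      (fun k hk k' hk' => hper k (hsub hk) k' (hsub hk'))
      (fun G₁ h => hG G₁ (h.trans hsub)) a' ha'K
      (fun k hk h => hge k (Finset.mem_filter.2 ⟨hk, h.trans hpa'⟩))
      (fun k hk => by rw [hpa']; exact minPrefixPeriod_mono v (hlt k hk))
    rw [hpa'] at IH
    have hta : t < a := by
      by_contra h
      have := minPrefixPeriod_mono v (not_lt.1 h)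
      have := hK'p t ht
      omega
    have ht1 := hpos t (hsub ht)
    have ha'1 := hpos a' (hsub ha'K)
    set P := minPrefixPeriod v t
    set P' := minPrefixPeriod v a
    have hPP : P < P' := hK'p t ht
    have h1 : P' ≤ a - t := minPrefixPeriod_le (by omega) (hper t (hsub ht) a ha hta)
    have h2 : t < P + P' := by
      by_contra h
      have := minPrefixPeriod_le (hp1 t) ((minPrefixPeriod_spec v t).2.extend
        (minPrefixPeriod_spec v a).2 (hp1 a) (not_lt.1 h))
      omega
    have h3 : (G'.card - 1) * P ≤ t - a' := by
      apply card_sub_one_mul_le (hlt a' ha'K)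
      intro k hk
      have hkK := (Finset.mem_filter.1 hk).1
      refine ⟨hge k hk, hlt k hkK, ?_⟩
      rcases (hge k hk).eq_or_lt with h | h
      · simp [← h]
      · have := minPrefixPeriod_dvd_sub ha'1 h.le (hper _ (hsub ha'K) _ (hsub hkK) h)
          ((Finset.mem_filter.1 hk).2.trans hpa'.symm)
        rwa [hpa'] at this
    have h4 : P ≤ a' := hpa' ▸ minPrefixPeriod_le_self v ha'1
    have h5 : (G'.card - 1) * P ≤ P' := by omega
    have hPpos : (0 : ℝ) < P := by exact_mod_cast hp1 t
    have hP'pos : (0 : ℝ) < P' := by exact_mod_cast hp1 a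
    have hapos : (0 : ℝ) < a := by exact_mod_cast ha1
    have ha'pos : (0 : ℝ) < a' := by exact_mod_cast ha'1
    have h6 := hβ (G'.card - 1)
      (by have := hG G' ((Finset.filter_subset _ _).trans hsub) P
            (fun k hk => (Finset.mem_filter.1 hk).2)
          omega) (P' / P)
      (by rw [one_le_div hPpos]; exact_mod_cast hPP.le)
      (by rw [le_div_iff₀ hPpos]; exact_mod_cast h5)
    rw [Real.logb_div hP'pos.ne' hPpos.ne'] at h6
    have h7 : Real.logb 2 1.5 ≤ Real.logb 2 (a / a') := by
      apply Real.logb_le_logb_of_le (by norm_num) (by norm_num)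
      rw [le_div_iff₀ ha'pos]
      have : 3 * a' ≤ 2 * a := by have := hlt a' ha'K; omega
      have : (3 : ℝ) * a' ≤ 2 * a := by exact_mod_cast this
      linarith
    rw [Real.logb_div hapos.ne' ha'pos.ne'] at h7
    have h8 := two_le_logb_three_halves
    have h9 : (G'.card : ℝ) = (G'.card - 1 : ℕ) + 1 := by
      have : 1 ≤ G'.card := hneG.card_pos
      exact_mod_cast (by omega : G'.card = G'.card - 1 + 1)
    rw [hsplitR]
    linarith

lemma card_le_of_group_card_le {v : ℕ → α} {r X : ℕ} {β : ℝ} (hβ0 : 0 ≤ β)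
    (hβ : ∀ h : ℕ, h ≤ r → ∀ y : ℝ, 1 ≤ y → (h : ℝ) ≤ y → (h : ℝ) ≤ 1 + β * Real.logb 2 y)
    (K : Finset ℕ) (hpos : ∀ k ∈ K, 1 ≤ k) (hX : ∀ k ∈ K, k ≤ X)
    (hper : ∀ k ∈ K, ∀ k' ∈ K, k < k' → PrefixPeriod v k' (k' - k))
    (hG : ∀ G ⊆ K, ∀ P, (∀ k ∈ G, minPrefixPeriod v k = P) → G.card ≤ r + 1) :
    (K.card : ℝ) ≤ 2 + (3.5 + β) * Real.logb 2 X := by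
  rcases K.eq_empty_or_nonempty with he | hne
  · have : 0 ≤ Real.logb 2 (X : ℝ) := by
      rcases Nat.eq_zero_or_pos X with rfl | h
      · simp
      · exact Real.logb_nonneg (by norm_num) (by exact_mod_cast h)
    rw [he, Finset.card_empty]
    push_cast
    nlinarith [mul_nonneg hβ0 this]
  set t := K.max' hne
  have ht : t ∈ K := K.max'_mem hne
  set G := K.filter (fun k => minPrefixPeriod v k = minPrefixPeriod v t)
  have hneG : G.Nonempty := ⟨t, Finset.mem_filter.2 ⟨ht, rfl⟩⟩
  set a := G.min' hneG
  have ha : a ∈ G := G.min'_mem hneG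
  have haK : a ∈ K := (Finset.mem_filter.1 ha).1
  have hpa : minPrefixPeriod v a = minPrefixPeriod v t := (Finset.mem_filter.1 ha).2
  have hlt : ∀ k ∈ K, k ≤ t := fun k hk => K.le_max' k hk
  have hge : ∀ k ∈ G, a ≤ k := fun k hk => G.min'_le k hk
  have main := card_le_card_group_add hβ0 hβ K hpos hper hG a haK
    (fun k hk h => hge k (Finset.mem_filter.2 ⟨hk, h.trans hpa⟩))
    (fun k hk => by rw [hpa]; exact minPrefixPeriod_mono v (hlt k hk))
  rw [hpa] at main
  have ha1 := hpos a haK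
  set P := minPrefixPeriod v t
  have hP1 : 1 ≤ P := (minPrefixPeriod_spec v t).1
  have hPX : P ≤ X := (minPrefixPeriod_le_self v (hpos t ht)).trans (hX t ht)
  have h3 : (G.card - 1) * P ≤ t - a := by
    apply card_sub_one_mul_le (hlt a haK)
    intro k hk
    have hkK := (Finset.mem_filter.1 hk).1
    refine ⟨hge k hk, hlt k hkK, ?_⟩
    rcases (hge k hk).eq_or_lt with h | h
    · simp [← h]
    · have := minPrefixPeriod_dvd_sub ha1 h.le (hper _ haK _ hkK h)
        ((Finset.mem_filter.1 hk).2.trans hpa.symm)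
      rwa [hpa] at this
  have h5 : (G.card - 1) * P ≤ X := by have := hX t ht; omega
  have hPpos : (0 : ℝ) < P := by exact_mod_cast hP1
  have hXpos : (0 : ℝ) < X := hPpos.trans_le (by exact_mod_cast hPX)
  have h6 := hβ (G.card - 1)
    (by have := hG G (Finset.filter_subset _ _) P (fun k hk => (Finset.mem_filter.1 hk).2)
        omega) (X / P)
    (by rw [one_le_div hPpos]; exact_mod_cast hPX)
    (by rw [le_div_iff₀ hPpos]; exact_mod_cast h5)
  rw [Real.logb_div hXpos.ne' hPpos.ne'] at h6
  have h7 : Real.logb 2 a ≤ Real.logb 2 X := by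
    apply Real.logb_le_logb_of_le (by norm_num) (by exact_mod_cast ha1)
    exact_mod_cast hX a haK
  have h9 : (G.card : ℝ) = (G.card - 1 : ℕ) + 1 := by
    have : 1 ≤ G.card := hneG.card_pos
    exact_mod_cast (by omega : G.card = G.card - 1 + 1)
  linarith

lemma le_one_add_mul_logb {q : ℕ} (hq : 3 ≤ q) (h : ℕ) (hh : h ≤ 2 * q) (y : ℝ) (hy : 1 ≤ y)
    (hhy : (h : ℝ) ≤ y) : (h : ℝ) ≤ 1 + 2 * q / Real.logb 2 q * Real.logb 2 y := by
  have hqR : (3 : ℝ) ≤ q := by exact_mod_cast hq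
  have hlogq : 0 < Real.log q := Real.log_pos (by linarith)
  have hlogy : 0 ≤ Real.log y := Real.log_nonneg hy
  have hlog2 : 0 < Real.log 2 := Real.log_pos (by norm_num)
  have e : 2 * (q : ℝ) / Real.logb 2 q * Real.logb 2 y = 2 * q * Real.log y / Real.log q := by
    unfold Real.logb
    field_simp
  rw [e]
  have hnn : 0 ≤ 2 * (q : ℝ) * Real.log y / Real.log q := by positivity
  rcases Nat.lt_or_ge h 2 with h2 | h2
  · have : (h : ℝ) ≤ 1 := by exact_mod_cast (by omega : h ≤ 1)
    linarith
  have hhpos : (0 : ℝ) < h := by exact_mod_cast (by omega : 0 < h)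
  have hexp : Real.exp 1 ≤ 3 := by
    have := Real.exp_one_lt_d9; linarith
  have key : Real.log (2 * q) / (2 * q) ≤ Real.log h / h := by
    rcases h2.eq_or_lt with rfl | h3
    · have e4 : Real.log ((2 : ℕ) : ℝ) / ((2 : ℕ) : ℝ) = Real.log 4 / 4 := by
        rw [show (4 : ℝ) = 2 ^ 2 by norm_num, Real.log_pow]; push_cast; ring
      rw [e4]
      exact Real.log_div_self_antitoneOn (show Real.exp 1 ≤ (4 : ℝ) by linarith)
        (show Real.exp 1 ≤ 2 * (q : ℝ) by linarith) (by linarith)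
    · have : (3 : ℝ) ≤ h := by exact_mod_cast h3
      exact Real.log_div_self_antitoneOn (show Real.exp 1 ≤ (h : ℝ) by linarith)
        (show Real.exp 1 ≤ 2 * (q : ℝ) by linarith) (by exact_mod_cast hh)
  have h1 : Real.log q ≤ Real.log (2 * q) := Real.log_le_log (by linarith) (by linarith)
  have h4 : Real.log h ≤ Real.log y := Real.log_le_log hhpos hhy
  have h5 : Real.log q / (2 * q) ≤ Real.log y / h :=
    (div_le_div_of_nonneg_right h1 (by linarith)).trans
      (key.trans (div_le_div_of_nonneg_right h4 hhpos.le))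
  rw [div_le_div_iff₀ (by linarith) hhpos] at h5
  have : (h : ℝ) ≤ 2 * q * Real.log y / Real.log q := by
    rw [le_div_iff₀ hlogq]; linarith
  linarith

/-- Two equal factors `s[n..n+l-1] = s[m..m+l-1]` that extend neither to the left nor to the
right, where the first padded occurrence crosses `b₁`, the second one crosses `b₂`, and the
offset of the crossing is larger by `k` in the first one. -/
structure CrossingPair (s : ℕ → α) (b₁ b₂ k n m l : ℕ) : Prop where
  one_le_left : 1 ≤ n
  one_le_right : 1 ≤ m
  diag : m + b₁ = b₂ + k + n
  add_le : n + k ≤ b₁ + 1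
  lt_add : b₁ < n + l
  eq_of_lt : ∀ i < l, s (n + i) = s (m + i)
  ne_before : s (n - 1) ≠ s (m - 1)
  ne_after : s (n + l) ≠ s (m + l)

namespace CrossingPair

variable {s : ℕ → α} {b₁ b₂ k n m l k' n' m' l' : ℕ}

lemma apply_eq (h : CrossingPair s b₁ b₂ k n m l) {x y : ℕ} (hx : n ≤ x) (hx' : x < n + l)
    (hxy : y + b₁ = x + b₂ + k) : s x = s y := by
  have hd := h.diag
  have := h.eq_of_lt (x - n) (by omega)
  rwa [show n + (x - n) = x by omega, show m + (x - n) = y by omega] at this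

lemma unique (h : CrossingPair s b₁ b₂ k n m l) (h' : CrossingPair s b₁ b₂ k n' m' l') :
    n = n' ∧ m = m' ∧ l = l' := by
  have key : ∀ {n m l n' m' l' : ℕ}, CrossingPair s b₁ b₂ k n m l →
      CrossingPair s b₁ b₂ k n' m' l' → n' ≤ n := by
    intro n m l n' m' l' h h'
    by_contra hlt
    obtain ⟨h1, h2, h3, h4, h5, h6, -, -⟩ := h
    obtain ⟨h1', h2', h3', h4', h5', -, h7', -⟩ := h'
    apply h7'
    have := h6 (n' - 1 - n) (by omega)
    rwa [show n + (n' - 1 - n) = n' - 1 by omega, show m + (n' - 1 - n) = m' - 1 by omega]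
      at this
  have hn : n = n' := le_antisymm (key h' h) (key h h')
  have hm : m = m' := by have := h.diag; have := h'.diag; omega
  subst hn hm
  refine ⟨rfl, rfl, ?_⟩
  rcases lt_trichotomy l l' with hl | hl | hl
  · exact absurd (h'.eq_of_lt l hl) h.ne_after
  · exact hl
  · exact absurd (h.eq_of_lt l' hl) h'.ne_after

lemma prefixPeriod (h : CrossingPair s b₁ b₂ k n m l) (h' : CrossingPair s b₁ b₂ k' n' m' l')
    (hk : k < k') : PrefixPeriod (fun i => s (b₂ + 1 + i)) k' (k' - k) := by
  intro i hi
  have h1 := h.add_le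
  have h2 := h'.add_le
  have h3 := h.lt_add
  have h4 := h'.lt_add
  have e1 := h.apply_eq (x := b₁ + 1 + i - k) (y := b₂ + 1 + i) (by omega) (by omega) (by omega)
  have e2 := h'.apply_eq (x := b₁ + 1 + i - k) (y := b₂ + 1 + (i + (k' - k)))
    (by omega) (by omega) (by omega)
  exact e1.symm.trans e2

lemma apply_eq_add (h : CrossingPair s b₁ b₂ k n m l) {P : ℕ}
    (hP : PrefixPeriod (fun i => s (b₂ + 1 + i)) k P) {x : ℕ} (hx : b₁ + 1 ≤ x + k)
    (hx' : x + P ≤ b₁) : s x = s (x + P) := by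
  have h1 := h.add_le
  have h3 := h.lt_add
  have e1 := h.apply_eq (x := x) (y := b₂ + 1 + (x + k - (b₁ + 1)))
    (by omega) (by omega) (by omega)
  have e2 := h.apply_eq (x := x + P) (y := b₂ + 1 + (x + k - (b₁ + 1) + P))
    (by omega) (by omega) (by omega)
  rw [e1, e2]
  exact hP _ (by omega)

lemma not_two_left_breaks (h : CrossingPair s b₁ b₂ k n m l)
    (h' : CrossingPair s b₁ b₂ k' n' m' l') (hk : k < k') {P : ℕ}
    (hP : PrefixPeriod (fun i => s (b₂ + 1 + i)) k' P) (hPk : P ≤ k) {x x' : ℕ}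
    (hx : n ≤ x) (hxk : x + k < b₁ + 1) (hne : s x ≠ s (x + P))
    (hx' : n' ≤ x') (hxk' : x' + k' < b₁ + 1) (hne' : s x' ≠ s (x' + P)) : False := by
  classical
  have h3 := h.lt_add
  have h4 := h'.lt_add
  let Q : ℕ → Prop := fun y => y + P ≤ b₁ ∧ s y ≠ s (y + P)
  have hQx : Q x := ⟨by omega, hne⟩
  have hQx' : Q x' := ⟨by omega, hne'⟩
  have hy : Q (Nat.findGreatest Q b₁) := Nat.findGreatest_spec (by omega : x ≤ b₁) hQx
  have hyx : x ≤ Nat.findGreatest Q b₁ := Nat.le_findGreatest (by omega) hQx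
  have hyx' : x' ≤ Nat.findGreatest Q b₁ := Nat.le_findGreatest (by omega) hQx'
  have hmax : ∀ w, Nat.findGreatest Q b₁ < w → w ≤ b₁ → ¬ Q w := fun w h1 h2 =>
    Nat.findGreatest_is_greatest h1 h2
  generalize Nat.findGreatest Q b₁ = y at hy hyx hyx' hmax
  obtain ⟨hyP, hyne⟩ := hy
  have hyk : y + k' < b₁ + 1 := by
    by_contra hc
    exact hyne (h'.apply_eq_add hP (by omega) hyP)
  have hd := h'.diag
  have e1 := h'.apply_eq (x := y) (y := y + b₂ + k' - b₁) (by omega) (by omega) (by omega)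
  have e2 := h'.apply_eq (x := y + P) (y := y + b₂ + k' - b₁ + P)
    (by omega) (by omega) (by omega)
  have e3 := h.apply_eq (x := y + (k' - k)) (y := y + b₂ + k' - b₁)
    (by omega) (by omega) (by omega)
  have e4 := h.apply_eq (x := y + (k' - k) + P) (y := y + b₂ + k' - b₁ + P)
    (by omega) (by omega) (by omega)
  apply hmax (y + (k' - k)) (by omega) (by omega)
  exact ⟨by omega, by rw [e3, e4, ← e1, ← e2]; exact hyne⟩

lemma not_two_right_breaks (h : CrossingPair s b₁ b₂ k n m l)
    (h' : CrossingPair s b₁ b₂ k' n' m' l') (hk : k < k') {P : ℕ}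
    (hP : PrefixPeriod (fun i => s (b₂ + 1 + i)) k' P) (hPk : P ≤ k) {x x' : ℕ}
    (hx : x + P < n + l) (hxP : b₁ < x + P) (hne : s x ≠ s (x + P))
    (hx' : x' + P < n' + l') (hxP' : b₁ < x' + P) (hne' : s x' ≠ s (x' + P)) : False := by
  classical
  have h1 := h.add_le
  have h2 := h'.add_le
  let Q : ℕ → Prop := fun y => b₁ < y + P ∧ s y ≠ s (y + P)
  have hex : ∃ y, Q y := ⟨x, hxP, hne⟩
  have hy : Q (Nat.find hex) := Nat.find_spec hex
  have hyx : Nat.find hex ≤ x := Nat.find_min' hex ⟨hxP, hne⟩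
  have hyx' : Nat.find hex ≤ x' := Nat.find_min' hex ⟨hxP', hne'⟩
  have hmin : ∀ w, w < Nat.find hex → ¬ Q w := fun w h1 => Nat.find_min hex h1
  generalize Nat.find hex = y at hy hyx hyx' hmin
  obtain ⟨hyP, hyne⟩ := hy
  have e1 := h.apply_eq (x := y) (y := y + b₂ + k - b₁) (by omega) (by omega) (by omega)
  have e2 := h.apply_eq (x := y + P) (y := y + b₂ + k - b₁ + P)
    (by omega) (by omega) (by omega)
  have e3 := h'.apply_eq (x := y - (k' - k)) (y := y + b₂ + k - b₁)
    (by omega) (by omega) (by omega)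
  have e4 := h'.apply_eq (x := y - (k' - k) + P) (y := y + b₂ + k - b₁ + P)
    (by omega) (by omega) (by omega)
  have e5 : s (y - (k' - k)) ≠ s (y - (k' - k) + P) := by
    rw [e3, e4, ← e1, ← e2]; exact hyne
  by_cases hc : b₁ < y - (k' - k) + P
  · exact hmin _ (by omega) ⟨hc, e5⟩
  · exact e5 (h'.apply_eq_add hP (by omega) (by omega))

end CrossingPair

/-- There is a crossing pair with offset difference `k` whose repeat has exponent `< r`. -/
def HasCrossingPair (s : ℕ → α) (r b₁ b₂ k : ℕ) : Prop :=
  ∃ n m l, CrossingPair s b₁ b₂ k n m l ∧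
    ∀ P, 1 ≤ P → (∀ i, i + P < l → s (n + i) = s (n + i + P)) → l < r * P

lemma card_le_of_minPrefixPeriod_eq {s : ℕ → α} {r b₁ b₂ : ℕ} (hr : 1 ≤ r) {G : Finset ℕ}
    (hpos : ∀ k ∈ G, 1 ≤ k) (hcr : ∀ k ∈ G, HasCrossingPair s r b₁ b₂ k) {P : ℕ}
    (hG : ∀ k ∈ G, minPrefixPeriod (fun i => s (b₂ + 1 + i)) k = P) : G.card ≤ r + 1 := by
  classical
  choose! n m l hc hexp using hcr
  have hPk : ∀ k ∈ G, P ≤ k := fun k hk => hG k hk ▸ minPrefixPeriod_le_self _ (hpos k hk)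
  have hper : ∀ k ∈ G, 1 ≤ P ∧ PrefixPeriod (fun i => s (b₂ + 1 + i)) k P := fun k hk =>
    hG k hk ▸ minPrefixPeriod_spec _ k
  let left : ℕ → Prop := fun k => ∃ x, n k ≤ x ∧ x + k < b₁ + 1 ∧ s x ≠ s (x + P)
  let right : ℕ → Prop := fun k => ∃ x, x + P < n k + l k ∧ b₁ < x + P ∧ s x ≠ s (x + P)
  have hleft : (G.filter left).card ≤ 1 := by
    have key : ∀ k ∈ G, left k → ∀ k' ∈ G, left k' → ¬ k < k' := by
      rintro k hk ⟨x, h1, h2, h3⟩ k' hk' ⟨x', h1', h2', h3'⟩ hlt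
      exact (hc k hk).not_two_left_breaks (hc k' hk') hlt (hper k' hk').2 (hPk k hk)
        h1 h2 h3 h1' h2' h3'
    rw [Finset.card_le_one]
    intro k hk k' hk'
    rw [Finset.mem_filter] at hk hk'
    have := key k hk.1 hk.2 k' hk'.1 hk'.2
    have := key k' hk'.1 hk'.2 k hk.1 hk.2
    omega
  have hright : (G.filter right).card ≤ 1 := by
    have key : ∀ k ∈ G, right k → ∀ k' ∈ G, right k' → ¬ k < k' := by
      rintro k hk ⟨x, h1, h2, h3⟩ k' hk' ⟨x', h1', h2', h3'⟩ hlt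
      exact (hc k hk).not_two_right_breaks (hc k' hk') hlt (hper k' hk').2 (hPk k hk)
        h1 h2 h3 h1' h2' h3'
    rw [Finset.card_le_one]
    intro k hk k' hk'
    rw [Finset.mem_filter] at hk hk'
    have := key k hk.1 hk.2 k' hk'.1 hk'.2
    have := key k' hk'.1 hk'.2 k hk.1 hk.2
    omega
  set H := G.filter (fun k => ¬ left k ∧ ¬ right k) with hH
  have hHcard : H.card ≤ r - 1 := by
    rcases H.eq_empty_or_nonempty with he | hne
    · simp [he]
    set a := H.min' hne
    have ha : a ∈ H := H.min'_mem hne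
    have haG : a ∈ G := (Finset.mem_filter.1 ha).1
    have hP1 := (hper a haG).1
    have hlt : ∀ k ∈ H, k < r * P := by
      intro k hk
      obtain ⟨hkG, hl, hr⟩ := Finset.mem_filter.1 hk
      have hck := hc k hkG
      have h1 := hck.add_le
      have h2 := hck.lt_add
      have := hexp k hkG P hP1 (fun i hi => by
        by_contra hcon
        by_cases hi1 : n k + i + k < b₁ + 1
        · exact hl ⟨n k + i, by omega, hi1, hcon⟩
        by_cases hi2 : b₁ < n k + i + P
        · exact hr ⟨n k + i, by omega, hi2, hcon⟩
        exact hcon (hck.apply_eq_add (hper k hkG).2 (by omega) (by omega)))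
      omega
    have hle := card_sub_one_mul_le (G := H) (a := a) (t := r * P - 1)
      (by have := hlt a ha; omega) (fun k hk => by
        have hkG := (Finset.mem_filter.1 hk).1
        have hak : a ≤ k := H.min'_le k hk
        refine ⟨hak, by have := hlt k hk; omega, ?_⟩
        rcases hak.eq_or_lt with h | h
        · simp [← h]
        · have := minPrefixPeriod_dvd_sub (hpos a haG) h.le
            ((hc a haG).prefixPeriod (hc k hkG) h) ((hG k hkG).trans (hG a haG).symm)
          rwa [hG a haG] at this)
    have h1 := hPk a haG
    have h2 := hlt a ha
    have h3 : (H.card - 1 + 1) * P < r * P := by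
      rw [Nat.add_mul, one_mul]; omega
    have h4 := lt_of_mul_lt_mul_right h3 (Nat.zero_le P)
    omega
  have hcover : G ⊆ G.filter left ∪ (G.filter right ∪ H) := by
    intro k hk
    simp only [hH, Finset.mem_union, Finset.mem_filter, hk, true_and]
    tauto
  have h1 := Finset.card_le_card hcover
  have h2 := Finset.card_union_le (G.filter left) (G.filter right ∪ H)
  have h3 := Finset.card_union_le (G.filter right) H
  omega

lemma card_le_of_hasCrossingPair {s : ℕ → α} {q b₁ b₂ X : ℕ} (hq : 3 ≤ q) (K : Finset ℕ)
    (hX : ∀ k ∈ K, k ≤ X) (hcr : ∀ k ∈ K, HasCrossingPair s (2 * q) b₁ b₂ k) :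
    (K.card : ℝ) ≤ 3 + (3.5 + 2 * q / Real.logb 2 q) * Real.logb 2 X := by
  have hqR : (3 : ℝ) ≤ q := by exact_mod_cast hq
  have hβ0 : 0 ≤ 2 * (q : ℝ) / Real.logb 2 q :=
    div_nonneg (by positivity) (Real.logb_nonneg (by norm_num) (by linarith))
  have hsub := Finset.erase_subset 0 K
  have hpos : ∀ k ∈ K.erase 0, 1 ≤ k := fun k hk =>
    Nat.one_le_iff_ne_zero.2 (Finset.ne_of_mem_erase hk)
  have main := card_le_of_group_card_le (v := fun i => s (b₂ + 1 + i)) hβ0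
    (le_one_add_mul_logb hq) (K.erase 0) hpos (fun k hk => hX k (hsub hk))
    (fun k hk k' hk' hlt => by
      obtain ⟨n, m, l, h, -⟩ := hcr k (hsub hk)
      obtain ⟨n', m', l', h', -⟩ := hcr k' (hsub hk')
      exact h.prefixPeriod h' hlt)
    (fun G hGK P hP => card_le_of_minPrefixPeriod_eq (by omega)
      (fun k hk => hpos k (hGK hk)) (fun k hk => hcr k (hsub (hGK hk))) hP)
  have h1 : (K.card : ℝ) ≤ (K.erase 0).card + 1 := by
    exact_mod_cast Nat.sub_le_iff_le_add.1 (Finset.pred_card_le_card_erase (s := K) (a := 0))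
  linarith

lemma chr_succ (dollar : α) (S : List α) (i : ℕ) :
    chr dollar S (i + 1) = (S[i]?).getD dollar := by
  unfold chr
  by_cases h : i < S.length
  · rw [dif_pos ⟨by omega, by omega⟩, List.getElem?_eq_getElem h]
    simp
  · rw [dif_neg (by omega), List.getElem?_eq_none (by omega)]
    simp

lemma substr_congr {dollar : α} {S : List α} {a a' w : ℕ}
    (h : ∀ i ≤ w, chr dollar S (a' + i) = chr dollar S (a + i)) :
    substr dollar S a' (a' + w) = substr dollar S a (a + w) := by
  unfold substr
  rw [show a' + w + 1 - a' = w + 1 by omega, show a + w + 1 - a = w + 1 by omega]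
  apply List.map_congr_left
  intro i hi
  exact h i (by have := List.mem_range.1 hi; omega)

lemma take_succ_flatten (L : List (List α)) (i : ℕ) (h : i < L.length) :
    (L.take (i + 1)).flatten = (L.take i).flatten ++ L[i] := by
  rw [List.take_succ_eq_append_getElem h, List.flatten_append]
  simp

/-- Within an LZ77-factor that is not a single letter, every window has an earlier copy. -/
lemma IsLZ77.exists_earlier {S : List α} {L : List (List α)} (hL : IsLZ77 S L) (dollar : α)
    {i : ℕ} (hi : i < L.length) (hlen : 2 ≤ L[i].length) :
    ∃ p < (L.take i).flatten.length, ∀ r < L[i].length,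
      chr dollar S (p + 1 + r) = chr dollar S ((L.take i).flatten.length + 1 + r) := by
  obtain ⟨hS, hf⟩ := hL
  obtain ⟨-, h⟩ := hf i hi
  simp only [List.get_eq_getElem] at h
  rcases h with ⟨c, hc, -⟩ | ⟨⟨p₁, p₂, h12, hp2, ho1, -⟩, -⟩
  · rw [hc] at hlen; simp at hlen
  rw [List.length_append] at hp2
  have hST : S = ((L.take i).flatten ++ L[i]) ++ (L.drop (i + 1)).flatten := by
    rw [← take_succ_flatten L i hi, ← List.flatten_append, List.take_append_drop, hS]
  refine ⟨p₁, by omega, fun r hr => ?_⟩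
  rw [show p₁ + 1 + r = p₁ + r + 1 by omega,
    show (L.take i).flatten.length + 1 + r = (L.take i).flatten.length + r + 1 by omega,
    chr_succ, chr_succ]
  congr 1
  have e1 : S[p₁ + r]? = L[i][r]? := by
    rw [hST, List.getElem?_append_left (by rw [List.length_append]; omega),
      ← List.getElem?_drop]
    obtain ⟨t, ht⟩ := ho1
    rw [← ht, List.getElem?_append_left hr]
  have e2 : S[(L.take i).flatten.length + r]? = L[i][r]? := by
    rw [hST, List.getElem?_append_left (by rw [List.length_append]; omega),
      List.getElem?_append_right (by omega), Nat.add_sub_cancel_left]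
  rw [e1, e2]

/-- Every padded window of length at least two has a copy crossing a factor boundary. -/
lemma IsLZ77.exists_crossing {S : List α} {L : List (List α)} (hL : IsLZ77 S L) (dollar : α)
    {a w : ℕ} (hw : 1 ≤ w) (haw : a + w ≤ S.length + 1) :
    ∃ a' ≤ a, (∀ i ≤ w, chr dollar S (a' + i) = chr dollar S (a + i)) ∧
      ∃ j ≤ L.length, a' ≤ (L.take j).flatten.length ∧ (L.take j).flatten.length < a' + w := by
  classical
  have hex : ∃ a', ∀ i ≤ w, chr dollar S (a' + i) = chr dollar S (a + i) := ⟨a, fun _ _ => rfl⟩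
  have hspec := Nat.find_spec hex
  have hle : Nat.find hex ≤ a := Nat.find_min' hex fun _ _ => rfl
  have hmin : ∀ w', w' < Nat.find hex → _ := fun w' h => Nat.find_min hex h
  generalize Nat.find hex = a' at hspec hle hmin
  refine ⟨a', hle, hspec, ?_⟩
  by_contra hno
  push Not at hno
  have hz : (L.take L.length).flatten.length = S.length := by rw [List.take_length, ← hL.1]
  have hexj : ∃ j, a' ≤ (L.take j).flatten.length := ⟨L.length, by omega⟩
  have hj := Nat.find_spec hexj
  have hjz : Nat.find hexj ≤ L.length := Nat.find_min' hexj (by omega)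
  have hjmin : ∀ j, j < Nat.find hexj → _ := fun j h => Nat.find_min hexj h
  generalize Nat.find hexj = j at hj hjz hjmin
  have h0 := hno 0 (Nat.zero_le _)
  have hjw := hno j hjz hj
  rcases j with _ | i
  · simp only [List.take_zero, List.flatten_nil, List.length_nil] at hj hjw
    omega
  have hi := hjmin i (by omega)
  have hlen : (L.take (i + 1)).flatten.length = (L.take i).flatten.length + L[i].length := by
    rw [take_succ_flatten L i (by omega), List.length_append]
  obtain ⟨p, hp, hcopy⟩ := hL.exists_earlier dollar (i := i) (by omega) (by omega)
  apply hmin (p + a' - (L.take i).flatten.length) (by omega)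
  intro x hx
  rw [← hspec x hx]
  have := hcopy (a' + x - (L.take i).flatten.length - 1) (by omega)
  rw [show p + 1 + (a' + x - (L.take i).flatten.length - 1)
      = p + a' - (L.take i).flatten.length + x by omega,
    show (L.take i).flatten.length + 1 + (a' + x - (L.take i).flatten.length - 1)
      = a' + x by omega] at this
  exact this

lemma lt_mul_of_not_isFracPowGe {dollar : α} {S : List α} {r n l : ℕ} (hl : 1 ≤ l)
    (h : ¬ IsFracPowGe r (substr dollar S n (n + l - 1))) {P : ℕ} (hP : 1 ≤ P)
    (hper : ∀ i, i + P < l → chr dollar S (n + i) = chr dollar S (n + i + P)) : l < r * P := by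
  have hlen : (substr dollar S n (n + l - 1)).length = l := by
    simp only [substr, List.length_map, List.length_range]; omega
  have hmin : minPeriod (substr dollar S n (n + l - 1)) ≤ P := by
    apply Nat.sInf_le
    refine ⟨hP, fun k hk => ?_⟩
    rw [hlen] at hk
    have := hper k hk
    simpa [substr, Nat.add_assoc] using this
  unfold IsFracPowGe at h
  rw [hlen, not_le] at h
  exact h.trans_le (Nat.mul_le_mul_left r hmin)

lemma exists_crossingPair {dollar : α} {S : List α} {L : List (List α)} (hL : IsLZ77 S L)
    {r : ℕ} {p : ℕ × ℕ × ℕ} (hp : IsMaximalPair dollar S p.1 p.2.1 p.2.2)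
    (hexp : ¬ IsFracPowGe r (substr dollar S p.1 (p.1 + p.2.2 - 1))) :
    ∃ j₁ j₂ k n m l, j₁ ≤ L.length ∧ j₂ ≤ L.length ∧
      CrossingPair (chr dollar S) (L.take j₁).flatten.length (L.take j₂).flatten.length k n m l ∧
      (∀ P, 1 ≤ P → (∀ i, i + P < l → chr dollar S (n + i) = chr dollar S (n + i + P)) →
        l < r * P) ∧
      CopiesMP dollar S p (n, m, l) := by
  obtain ⟨n₀, m₀, l⟩ := p
  obtain ⟨hl, hn, hm, hnS, hmS, heq, hne, hne'⟩ := hp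
  simp only at hl hn hm hnS hmS heq hne hne' hexp
  obtain ⟨a, -, ha, j₁, hj₁, h1, h1'⟩ :=
    hL.exists_crossing dollar (a := n₀ - 1) (w := l + 1) (by omega) (by omega)
  obtain ⟨b, -, hb, j₂, hj₂, h2, h2'⟩ :=
    hL.exists_crossing dollar (a := m₀ - 1) (w := l + 1) (by omega) (by omega)
  have ea : ∀ i ≤ l, chr dollar S (a + 1 + i) = chr dollar S (n₀ + i) := fun i hi => by
    have := ha (i + 1) (by omega)
    rwa [show a + (i + 1) = a + 1 + i by omega, show n₀ - 1 + (i + 1) = n₀ + i by omega] at this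
  have eb : ∀ i ≤ l, chr dollar S (b + 1 + i) = chr dollar S (m₀ + i) := fun i hi => by
    have := hb (i + 1) (by omega)
    rwa [show b + (i + 1) = b + 1 + i by omega, show m₀ - 1 + (i + 1) = m₀ + i by omega] at this
  have ea0 : chr dollar S a = chr dollar S (n₀ - 1) := ha 0 (by omega)
  have eb0 : chr dollar S b = chr dollar S (m₀ - 1) := hb 0 (by omega)
  have sa : substr dollar S (n₀ - 1) (n₀ + l) = substr dollar S a (a + 1 + l) := by
    have := substr_congr ha
    rw [show a + 1 + l = a + (l + 1) by omega, this]
    congr 1; omega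
  have sb : substr dollar S (m₀ - 1) (m₀ + l) = substr dollar S b (b + 1 + l) := by
    have := substr_congr hb
    rw [show b + 1 + l = b + (l + 1) by omega, this]
    congr 1; omega
  have hab : ∀ i < l, chr dollar S (a + 1 + i) = chr dollar S (b + 1 + i) := fun i hi => by
    rw [ea i hi.le, eb i hi.le, heq i hi]
  have hexpa : ∀ P, 1 ≤ P →
      (∀ i, i + P < l → chr dollar S (a + 1 + i) = chr dollar S (a + 1 + i + P)) →
      l < r * P := fun P hP h => lt_mul_of_not_isFracPowGe hl hexp hP fun i hi => by
    have := h i hi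
    rwa [Nat.add_assoc (a + 1), ea _ (by omega), ea _ (by omega), ← Nat.add_assoc n₀] at this
  rcases le_total (b + (L.take j₁).flatten.length) (a + (L.take j₂).flatten.length) with h | h
  · refine ⟨j₂, j₁, a + (L.take j₂).flatten.length - (b + (L.take j₁).flatten.length),
      b + 1, a + 1, l, hj₂, hj₁, ⟨by omega, by omega, by omega, by omega, by omega,
        fun i hi => (hab i hi).symm, ?_, ?_⟩, ?_, ?_⟩
    · simpa [ea0, eb0] using hne.symm
    · rw [ea l le_rfl, eb l le_rfl]; exact hne'.symm
    · intro P hP hper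
      refine hexpa P hP fun i hi => ?_
      rw [hab i (by omega), Nat.add_assoc (a + 1), hab (i + P) hi, ← Nat.add_assoc (b + 1)]
      exact hper i hi
    · simp only [CopiesMP, Nat.add_sub_cancel]
      rw [sa, sb, Set.pair_comm]
  · refine ⟨j₁, j₂, b + (L.take j₁).flatten.length - (a + (L.take j₂).flatten.length),
      a + 1, b + 1, l, hj₁, hj₂, ⟨by omega, by omega, by omega, by omega, by omega,
        hab, ?_, ?_⟩, hexpa, ?_⟩
    · simpa [ea0, eb0] using hne
    · rw [ea l le_rfl, eb l le_rfl]; exact hne'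
    · simp only [CopiesMP, Nat.add_sub_cancel]
      rw [sa, sb]

lemma card_le_of_not_copies (dollar : α) (S : List α) (L : List (List α)) (hL : IsLZ77 S L)
    {q : ℕ} (hq : 3 ≤ q) (M : Finset (ℕ × ℕ × ℕ))
    (hM : ∀ p ∈ M, IsMaximalPair dollar S p.1 p.2.1 p.2.2 ∧
      ¬ IsFracPowGe (2 * q) (substr dollar S p.1 (p.1 + p.2.2 - 1)))
    (hdiff : ∀ p ∈ M, ∀ p' ∈ M, p ≠ p' → ¬ CopiesMP dollar S p p') :
    (M.card : ℝ) ≤ ((L.length : ℝ) + 1) * (L.length + 1) *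
      (3 + (3.5 + 2 * q / Real.logb 2 q) * Real.logb 2 S.length) := by
  classical
  have hex : ∀ p ∈ M, _ := fun p hp => exists_crossingPair hL (hM p hp).1 (hM p hp).2
  choose! j₁ j₂ k n m l hj₁ hj₂ hc hexp hcopy using hex
  have hmaps : Set.MapsTo (fun p => (j₁ p, j₂ p)) (M : Set (ℕ × ℕ × ℕ))
      (Finset.range (L.length + 1) ×ˢ Finset.range (L.length + 1) : Finset (ℕ × ℕ)) := by
    intro p hp
    have h1 := hj₁ p hp
    have h2 := hj₂ p hp
    simp only [Finset.coe_product, Set.mem_prod, Finset.coe_range, Set.mem_Iio]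
    omega
  rw [Finset.card_eq_sum_card_fiberwise hmaps]
  push_cast
  refine (Finset.sum_le_card_nsmul _ _
    (3 + (3.5 + 2 * q / Real.logb 2 q) * Real.logb 2 S.length) ?_).trans_eq ?_
  · rintro ⟨i₁, i₂⟩ -
    set F := M.filter (fun p => (j₁ p, j₂ p) = (i₁, i₂)) with hF
    have hFM : ∀ p ∈ F, p ∈ M ∧ j₁ p = i₁ ∧ j₂ p = i₂ := fun p hp => by
      simpa [hF] using hp
    have hinj : Set.InjOn k (F : Set (ℕ × ℕ × ℕ)) := by
      intro p hp p' hp' hk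
      obtain ⟨hpM, h1, h2⟩ := hFM p hp
      obtain ⟨hpM', h1', h2'⟩ := hFM p' hp'
      by_contra hne
      apply hdiff p hpM p' hpM' hne
      have c := hc p hpM
      have c' := hc p' hpM'
      rw [h1, h2] at c
      rw [h1', h2', ← hk] at c'
      obtain ⟨e1, e2, e3⟩ := c.unique c'
      have d := hcopy p hpM
      have d' := hcopy p' hpM'
      rw [← e1, ← e2, ← e3] at d'
      exact d.trans d'.symm
    rw [← Finset.card_image_of_injOn hinj]
    apply card_le_of_hasCrossingPair (s := chr dollar S)
      (b₁ := (L.take i₁).flatten.length) (b₂ := (L.take i₂).flatten.length) hq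
    · intro x hx
      obtain ⟨p, hp, rfl⟩ := Finset.mem_image.1 hx
      obtain ⟨hpM, h1, h2⟩ := hFM p hp
      have c := hc p hpM
      have h3 := c.one_le_left
      have h4 := c.add_le
      have h5 : (L.take (j₁ p)).flatten.length ≤ S.length := by
        conv_rhs => rw [hL.1, ← List.take_append_drop (j₁ p) L, List.flatten_append,
          List.length_append]
        omega
      omega
    · intro x hx
      obtain ⟨p, hp, rfl⟩ := Finset.mem_image.1 hx
      obtain ⟨hpM, h1, h2⟩ := hFM p hp
      exact ⟨n p, m p, l p, by rw [← h1, ← h2]; exact hc p hpM, hexp p hpM⟩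
  · rw [Finset.card_product, Finset.card_range, nsmul_eq_mul]
    push_cast
    ring

lemma two_le_length_of_isMaximalPair {dollar : α} {S : List α} {n m l : ℕ}
    (h : IsMaximalPair dollar S n m l) : 2 ≤ S.length := by
  obtain ⟨hl, hn, hm, hnS, hmS, -, hne, -⟩ := h
  by_contra hlt
  have : n = m := by omega
  exact hne (by rw [this])

/-- If `S` has `z` LZ77-factors and `q ≥ 3`, then there are at most
`6·(1 + 3q/log₂q)·log₂|S|·(z+1)·(z+2)` pairwise substantially different maximal pairs whose
corresponding maximal repeat is not a fractional power with exponent `≥ 2q`; in particular,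
for `q = 3`, at most `41·log₂|S|·(z+1)·(z+2)`. -/
theorem substantially_different_maximal_pairs_bound (dollar : α) (S : List α)
    (hdollar : dollar ∉ S)
    (L : List (List α)) (z : ℕ) (hL : IsLZ77 S L) (hz : L.length = z)
    (q : ℕ) (hq : 3 ≤ q)
    (M : Finset (ℕ × ℕ × ℕ))
    (hM : ∀ p ∈ M, IsMaximalPair dollar S p.1 p.2.1 p.2.2 ∧
      ¬ IsFracPowGe (2 * q) (substr dollar S p.1 (p.1 + p.2.2 - 1)))
    (hdiff : ∀ p ∈ M, ∀ p' ∈ M, p ≠ p' → ¬ CopiesMP dollar S p p') :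
    (M.card : ℝ) ≤ 6 * (1 + 3 * (q : ℝ) / Real.logb 2 (q : ℝ)) * Real.logb 2 (S.length : ℝ)
        * ((z : ℝ) + 1) * ((z : ℝ) + 2) ∧
    (q = 3 → (M.card : ℝ) ≤ 41 * Real.logb 2 (S.length : ℝ) * ((z : ℝ) + 1) * ((z : ℝ) + 2)) := by
  subst hz
  have hqR : (3 : ℝ) ≤ q := by exact_mod_cast hq
  have hlogq : 0 < Real.logb 2 (q : ℝ) := Real.logb_pos (by norm_num) (by linarith)
  have hlogS : 0 ≤ Real.logb 2 (S.length : ℝ) := by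
    rcases Nat.eq_zero_or_pos S.length with h | h
    · simp [h]
    · exact Real.logb_nonneg (by norm_num) (by exact_mod_cast h)
  have hz0 : (0 : ℝ) ≤ L.length := Nat.cast_nonneg _
  have hB : 0 ≤ (q : ℝ) / Real.logb 2 q := by positivity
  have hmain : (M.card : ℝ) ≤ 6 * (1 + 3 * (q : ℝ) / Real.logb 2 (q : ℝ)) *
      Real.logb 2 (S.length : ℝ) * ((L.length : ℝ) + 1) * ((L.length : ℝ) + 2) := by
    rcases M.eq_empty_or_nonempty with rfl | ⟨p, hp⟩
    · rw [Finset.card_empty, Nat.cast_zero]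
      positivity
    have hS2 : 1 ≤ Real.logb 2 (S.length : ℝ) := by
      have h2 : (2 : ℝ) ≤ S.length := by
        exact_mod_cast two_le_length_of_isMaximalPair (hM p hp).1
      rw [Real.le_logb_iff_rpow_le (by norm_num) (by linarith), Real.rpow_one]
      exact h2
    have hB1 : 1 ≤ (q : ℝ) / Real.logb 2 q := by
      rw [one_le_div hlogq, Real.logb_le_iff_le_rpow (by norm_num) (by linarith),
        Real.rpow_natCast]
      exact_mod_cast Nat.lt_two_pow_self.le
    calc (M.card : ℝ) ≤ _ := card_le_of_not_copies dollar S L hL hq M hM hdiff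
      _ ≤ ((L.length : ℝ) + 1) * (L.length + 2) *
          (6 * (1 + 3 * (q : ℝ) / Real.logb 2 q) * Real.logb 2 S.length) := by
        gcongr
        · norm_num
        · rw [mul_div_assoc, mul_div_assoc]
          nlinarith [mul_le_mul_of_nonneg_right hB1 hlogS]
      _ = _ := by ring
  refine ⟨hmain, ?_⟩
  rintro rfl
  refine hmain.trans ?_
  have hlog3 : (54 / 35 : ℝ) ≤ Real.logb 2 3 := by
    have h1 : (35 : ℝ) * Real.logb 2 3 = Real.logb 2 (3 ^ 35) := by
      rw [Real.logb_pow]; norm_num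
    have h2 : (54 : ℝ) = Real.logb 2 (2 ^ 54) := by
      rw [Real.logb_pow, Real.logb_self_eq_one (by norm_num)]; norm_num
    have h3 : Real.logb 2 ((2 : ℝ) ^ 54) ≤ Real.logb 2 (3 ^ 35) :=
      Real.logb_le_logb_of_le (by norm_num) (by norm_num) (by norm_num)
    linarith
  have hcoef : 6 * (1 + 3 * ((3 : ℕ) : ℝ) / Real.logb 2 ((3 : ℕ) : ℝ)) ≤ 41 := by
    have : 3 * ((3 : ℕ) : ℝ) / Real.logb 2 ((3 : ℕ) : ℝ) ≤ 35 / 6 := by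
      rw [div_le_iff₀ hlogq]
      push_cast
      linarith
    linarith
  gcongr
end

section
/- Let S be a string with z LZ77-factors. Then there are at most 32·(z+1)²·log₂|S| pairwise substantially different maximal pairs (n, m, l) of S such that both positioned occurrences S[n..n+l−1] and S[m..m+l−1] of the corresponding maximal repeat are fractional powers with exponent ≥ 4, and at least one of the two maximal periodic extensions of these occurrences adds at most one period length of additional characters. -/
variable {α : Type*}

/-- `f` has period `p` on the half-open interval `[a, b)`. -/
def PeriodicOn (f : ℕ → α) (p a b : ℕ) : Prop :=
  ∀ i, a ≤ i → i + p < b → f i = f (i + p)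

theorem PeriodicOn.mono {f : ℕ → α} {p a b a' b' : ℕ} (h : PeriodicOn f p a b)
    (ha : a ≤ a') (hb : b' ≤ b) : PeriodicOn f p a' b' :=
  fun i hi hib => h i (by omega) (by omega)

theorem PeriodicOn.eq_add_mul {f : ℕ → α} {p a b : ℕ} (h : PeriodicOn f p a b) {i : ℕ}
    (hi : a ≤ i) (c : ℕ) (hc : i + c * p < b) : f i = f (i + c * p) := by
  induction c with
  | zero => simp
  | succ c ih =>
    have e : i + (c + 1) * p = i + c * p + p := by ring
    rw [e] at hc ⊢
    rw [ih (by omega)]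
    exact h _ (by omega) hc

theorem PeriodicOn.eq_of_modEq {f : ℕ → α} {p a b : ℕ} (h : PeriodicOn f p a b) {i j : ℕ}
    (hi : a ≤ i) (hib : i < b) (hj : a ≤ j) (hjb : j < b) (hij : i ≡ j [MOD p]) :
    f i = f j := by
  rcases le_total i j with hle | hle
  · obtain ⟨c, hc⟩ := (Nat.modEq_iff_dvd' hle).1 hij
    have e : j = i + c * p := by rw [mul_comm]; omega
    rw [e]
    exact h.eq_add_mul hi c (by omega)
  · obtain ⟨c, hc⟩ := (Nat.modEq_iff_dvd' hle).1 hij.symm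
    have e : i = j + c * p := by rw [mul_comm]; omega
    rw [e]
    exact (h.eq_add_mul hj c (by omega)).symm

/-- A period of a window of length at least `p + d` of a `p`-periodic interval is a period of
the whole interval. -/
theorem PeriodicOn.of_window {f : ℕ → α} {p d a b x y : ℕ} (hp : 1 ≤ p)
    (h : PeriodicOn f p a b) (hd : PeriodicOn f d x y) (hax : a ≤ x) (hyb : y ≤ b)
    (hxy : x + p + d ≤ y) : PeriodicOn f d a b := by
  intro i hi hib
  obtain ⟨i', h1, h2, h3⟩ : ∃ i', x ≤ i' ∧ i' < x + p ∧ i ≡ i' [MOD p] := by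
    refine ⟨x + (i + x * p - x) % p, by omega, ?_, ?_⟩
    · have := Nat.mod_lt (i + x * p - x) hp
      omega
    · have hx : x ≤ i + x * p := by nlinarith
      have h1 : x + (i + x * p - x) % p ≡ x + (i + x * p - x) [MOD p] :=
        (Nat.mod_modEq _ _).add_left x
      have h2 : x + (i + x * p - x) = i + x * p := by omega
      rw [h2] at h1
      refine Nat.ModEq.symm (h1.trans ?_)
      simp [Nat.ModEq]
  rw [h.eq_of_modEq hi (by omega) (by omega : a ≤ i') (by omega) h3,
    h.eq_of_modEq (by omega : a ≤ i + d) hib (by omega : a ≤ i' + d) (by omega)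
      (h3.add_right d)]
  exact hd i' h1 (by omega)

/-- A weak form of the periodicity lemma of Fine and Wilf. -/
theorem PeriodicOn.gcd {f : ℕ → α} : ∀ (s p q a b : ℕ), p + q ≤ s → 1 ≤ p → 1 ≤ q →
    PeriodicOn f p a b → PeriodicOn f q a b → a + p + q ≤ b →
    PeriodicOn f (Nat.gcd p q) a b := by
  intro s
  induction s with
  | zero => intros; omega
  | succ s ih =>
    intro p q a b hs hp hq h h' hab
    have key : ∀ p q : ℕ, p + q ≤ s + 1 → 1 ≤ p → p < q → PeriodicOn f p a b →
        PeriodicOn f q a b → a + p + q ≤ b → PeriodicOn f (Nat.gcd p q) a b := by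
      intro p q hs hp hpq h h' hab
      have hsub : PeriodicOn f (q - p) a (b - p) := by
        intro i hi hib
        rw [h' i hi (by omega), h (i + (q - p)) (by omega) (by omega)]
        congr 1
        omega
      have hg := ih p (q - p) a (b - p) (by omega) hp (by omega)
        (h.mono le_rfl (by omega)) hsub (by omega)
      rw [Nat.gcd_sub_self_right hpq.le] at hg
      have hle : Nat.gcd p q ≤ q - p := by
        rw [← Nat.gcd_sub_self_right hpq.le]
        exact Nat.gcd_le_right _ (by omega)
      exact h.of_window hp hg le_rfl (by omega) (by omega)
    rcases lt_trichotomy p q with hlt | heq | hlt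
    · exact key p q hs hp hlt h h' hab
    · subst heq
      simpa using h
    · rw [Nat.gcd_comm]
      exact key q p (by omega) hq hlt h' h (by omega)

/-- Three prefix squares with root lengths `u < v < w < 2u` force the shortest one to have a
period smaller than `u`. -/
theorem exists_short_period_of_three_squares {f : ℕ → α} {u v w : ℕ} (huv : u < v)
    (hvw : v < w) (hw : w < 2 * u) (hu : PeriodicOn f u 0 (2 * u))
    (hv : PeriodicOn f v 0 (2 * v)) (hw' : PeriodicOn f w 0 (2 * w)) :
    ∃ d, 1 ≤ d ∧ d < u ∧ PeriodicOn f d 0 (2 * u) := by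
  have h1 : PeriodicOn f (w - v) v (v + w) := by
    intro j hj hjb
    have e1 := hv (j - v) (by omega) (by omega)
    have e2 := hw' (j - v) (by omega) (by omega)
    rw [show j - v + v = j by omega] at e1
    rw [show j - v + w = j + (w - v) by omega] at e2
    rw [← e1, e2]
  have h2 : PeriodicOn f (w - u) u (u + w) := by
    intro j hj hjb
    have e1 := hu (j - u) (by omega) (by omega)
    have e2 := hw' (j - u) (by omega) (by omega)
    rw [show j - u + u = j by omega] at e1
    rw [show j - u + w = j + (w - u) by omega] at e2
    rw [← e1, e2]
  have hg := PeriodicOn.gcd _ (w - v) (w - u) v (u + w) le_rfl (by omega) (by omega)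
    (h1.mono le_rfl (by omega)) (h2.mono (by omega) le_rfl) (by omega)
  have hg1 : Nat.gcd (w - v) (w - u) ≤ w - v := Nat.gcd_le_left _ (by omega)
  have hg2 : Nat.gcd (w - v) (w - u) ≤ v - u := by
    have e : w - u = (v - u) + (w - v) := by omega
    rw [e, Nat.gcd_add_self_right]
    exact Nat.gcd_le_right _ (by omega)
  have hg0 : 1 ≤ Nat.gcd (w - v) (w - u) := Nat.gcd_pos_of_pos_left _ (by omega)
  set g := Nat.gcd (w - v) (w - u)
  have h3 : PeriodicOn f g u (u + w) :=
    h2.of_window (by omega) hg (by omega) le_rfl (by omega)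
  refine ⟨g, hg0, by omega, ?_⟩
  intro i hi hib
  by_cases hiu : u ≤ i
  · exact h3 i hiu (by omega)
  · have e1 := hv i hi (by omega)
    have e2 := hv (i + g) (by omega) (by omega)
    have e3 := hg (i + v) (by omega) (by omega)
    rw [e1, e2, e3]
    congr 1
    omega

theorem chr_of_mem (dollar : α) (S : List α) {i : ℕ} (h1 : 1 ≤ i) (h2 : i ≤ S.length) :
    chr dollar S i = S[i - 1]'(by omega) := by
  simp [chr, h1, h2]

theorem chr_ne_dollar {dollar : α} {S : List α} (hS : dollar ∉ S) {i : ℕ} (h1 : 1 ≤ i)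
    (h2 : i ≤ S.length) : chr dollar S i ≠ dollar := by
  rw [chr_of_mem dollar S h1 h2]
  intro h
  exact hS (h ▸ List.getElem_mem _)

theorem chr_eq_dollar (dollar : α) (S : List α) {i : ℕ} (h : i = 0 ∨ S.length < i) :
    chr dollar S i = dollar := by
  unfold chr
  rw [dif_neg (by omega)]

@[simp] theorem length_substr (dollar : α) (S : List α) (a b : ℕ) :
    (substr dollar S a b).length = b + 1 - a := by
  simp [substr]

@[simp] theorem getElem_substr (dollar : α) (S : List α) (a b k : ℕ)
    (h : k < (substr dollar S a b).length) :
    (substr dollar S a b)[k] = chr dollar S (a + k) := by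
  simp [substr]

theorem getD_substr (dollar : α) (S : List α) {a b k : ℕ} (h : k < b + 1 - a) :
    (substr dollar S a b).getD k dollar = chr dollar S (a + k) := by
  rw [List.getD_eq_getElem _ _ (by simpa using h), getElem_substr]

theorem substr_eq_substr {dollar : α} {S : List α} {a b a' b' : ℕ}
    (h : b + 1 - a = b' + 1 - a')
    (h' : ∀ k, k < b + 1 - a → chr dollar S (a + k) = chr dollar S (a' + k)) :
    substr dollar S a b = substr dollar S a' b' := by
  apply List.ext_getElem
  · simpa using h
  · intro k h1 h2
    simpa using h' k (by simpa using h1)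

theorem isPeriodOf_substr (dollar : α) (S : List α) (p a b : ℕ) :
    IsPeriodOf p (substr dollar S a b) ↔
      1 ≤ p ∧ PeriodicOn (chr dollar S) p a (b + 1) := by
  unfold IsPeriodOf PeriodicOn
  refine and_congr_right fun _ => ⟨fun h i hi hib => ?_, fun h k hk => ?_⟩
  · have := h (i - a) (by simp; omega)
    simp only [List.get_eq_getElem, getElem_substr] at this
    rw [show a + (i - a) = i by omega, show a + (i - a + p) = i + p by omega] at this
    exact this
  · simp only [length_substr] at hk
    simp only [List.get_eq_getElem, getElem_substr]
    rw [← add_assoc]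
    exact h _ (by omega) (by omega)

theorem isPeriodOf_minPeriod (T : List α) : IsPeriodOf (minPeriod T) T :=
  Nat.sInf_mem (s := {p | IsPeriodOf p T}) ⟨T.length + 1, by omega, fun k h => by omega⟩

theorem minPeriod_le {T : List α} {p : ℕ} (h : IsPeriodOf p T) : minPeriod T ≤ p :=
  Nat.sInf_le (s := {p | IsPeriodOf p T}) h

/-- `[l, r)` is a maximal repetition of `S` with minimal period `p` and exponent at least `4`. -/
structure IsRun (dollar : α) (S : List α) (p l r : ℕ) : Prop where
  one_le_period : 1 ≤ p
  one_le_left : 1 ≤ l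
  right_le : r ≤ S.length + 1
  length_ge : l + 4 * p ≤ r
  periodicOn : PeriodicOn (chr dollar S) p l r
  minimal : ∀ d, 1 ≤ d → PeriodicOn (chr dollar S) d l r → p ≤ d
  left_break : chr dollar S (l - 1) ≠ chr dollar S (l - 1 + p)
  right_break : chr dollar S r ≠ chr dollar S (r - p)

theorem IsRun.unique {dollar : α} {S : List α} {p l r l' r' : ℕ}
    (h : IsRun dollar S p l r) (h' : IsRun dollar S p l' r')
    (h1 : l + p ≤ r') (h2 : l' + p ≤ r) : l = l' ∧ r = r' := by
  have hp := h.one_le_period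
  have hl := h.one_le_left
  have hl' := h'.one_le_left
  have a1 := h.length_ge
  have a2 := h'.length_ge
  refine ⟨?_, ?_⟩
  · rcases lt_trichotomy l l' with hlt | heq | hlt
    · exact absurd (h.periodicOn (l' - 1) (by omega) (by omega)) h'.left_break
    · exact heq
    · exact absurd (h'.periodicOn (l - 1) (by omega) (by omega)) h.left_break
  · rcases lt_trichotomy r r' with hlt | heq | hlt
    · have := h'.periodicOn (r - p) (by omega) (by omega)
      rw [show r - p + p = r by omega] at this
      exact absurd this.symm h.right_break
    · exact heq
    · have := h.periodicOn (r' - p) (by omega) (by omega)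
      rw [show r' - p + p = r' by omega] at this
      exact absurd this.symm h'.right_break

/-- A copy of a padded run is a padded run. -/
theorem IsRun.shift {dollar : α} {S : List α} {p l r d : ℕ}
    (h : IsRun dollar S p l r) (hd : d < l)
    (hc : ∀ x, l - 1 ≤ x → x ≤ r → chr dollar S (x - d) = chr dollar S x) :
    IsRun dollar S p (l - d) (r - d) := by
  obtain ⟨h1, h2, h3, h4, h5, h6, h7, h8⟩ := h
  by_cases hd0 : d = 0
  · subst hd0
    exact ⟨h1, h2, h3, h4, h5, h6, h7, h8⟩
  refine ⟨h1, by omega, by omega, by omega, ?_, ?_, ?_, ?_⟩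
  · intro i hi hib
    have e1 := hc (i + d) (by omega) (by omega)
    have e2 := hc (i + d + p) (by omega) (by omega)
    rw [show i + d - d = i by omega] at e1
    rw [show i + d + p - d = i + p by omega] at e2
    rw [e1, e2]
    exact h5 _ (by omega) (by omega)
  · intro e he hper
    refine h6 e he fun i hi hib => ?_
    rw [← hc i (by omega) (by omega), ← hc (i + e) (by omega) (by omega),
      show i + e - d = i - d + e by omega]
    exact hper _ (by omega) (by omega)
  · have e1 := hc (l - 1) (by omega) (by omega)
    have e2 := hc (l - 1 + p) (by omega) (by omega)
    rw [show l - d - 1 = l - 1 - d by omega, e1,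
      show l - 1 - d + p = l - 1 + p - d by omega, e2]
    exact h7
  · have e1 := hc r (by omega) (by omega)
    have e2 := hc (r - p) (by omega) (by omega)
    rw [e1, show r - d - p = r - p - d by omega, e2]
    exact h8

/-- `w` is a run of `S`, padded by one character on either side, whose period lies in
`[2 ^ k, 2 ^ (k + 1))`. -/
def IsPaddedRun (dollar : α) (S : List α) (k : ℕ) (w : List α) : Prop :=
  ∃ p l r, 2 ^ k ≤ p ∧ p < 2 ^ (k + 1) ∧ IsRun dollar S p l r ∧ w = substr dollar S (l - 1) r

/-- The total length of the first `i` factors. -/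
def factorStart (L : List (List α)) (i : ℕ) : ℕ := ((L.take i).flatten).length

theorem factorStart_succ (L : List (List α)) {i : ℕ} (hi : i < L.length) :
    factorStart L (i + 1) = factorStart L i + L[i].length := by
  unfold factorStart
  rw [List.take_add_one, List.getElem?_eq_getElem hi]
  simp only [Option.toList_some, List.flatten_append, List.flatten_singleton, List.length_append]

theorem IsLZ77.exists_earlier_copy (dollar : α) {S : List α} {L : List (List α)}
    (hL : IsLZ77 S L) {i : ℕ} (hi : i < L.length) (h2 : 2 ≤ L[i].length) :
    ∃ d, 1 ≤ d ∧ d ≤ factorStart L i ∧ ∀ x, factorStart L i + 1 ≤ x →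
      x ≤ factorStart L (i + 1) → chr dollar S (x - d) = chr dollar S x := by
  obtain ⟨hS, hF⟩ := hL
  obtain ⟨-, hfac⟩ := hF i hi
  simp only [List.get_eq_getElem] at hfac
  rcases hfac with ⟨c, hc, -⟩ | ⟨⟨p₁, p₂, hp, hlen, hpre, -⟩, -⟩
  · rw [hc] at h2
    simp at h2
  have hT : (L.take i).flatten ++ L[i] <+: S := by
    refine ⟨(L.drop (i + 1)).flatten, ?_⟩
    rw [hS]
    conv_rhs => rw [← List.take_append_drop i L]
    rw [List.flatten_append, List.drop_eq_getElem_cons hi, List.flatten_cons,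
      List.append_assoc]
  have hlen' : ((L.take i).flatten ++ L[i]).length = factorStart L i + L[i].length := by
    simp [factorStart]
  have hs := factorStart_succ L hi
  have hST := hT.length_le
  rw [hlen'] at hlen hST
  refine ⟨factorStart L i - p₁, by omega, by omega, fun x hx hx' => ?_⟩
  have hj : x - 1 - factorStart L i < L[i].length := by omega
  have e1 : S[x - (factorStart L i - p₁) - 1]'(by omega) = L[i][x - 1 - factorStart L i] := by
    have a := hpre.getElem hj
    rw [a, List.getElem_drop, hT.getElem]
    congr 1
    omega
  have e2 : S[x - 1]'(by omega) = L[i][x - 1 - factorStart L i] := by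
    rw [← hT.getElem (by rw [hlen']; omega), List.getElem_append_right (by
      simp only [factorStart] at hx; omega)]
    rfl
  rw [chr_of_mem dollar S (by omega) (by omega), chr_of_mem dollar S (by omega) (by omega),
    e1, e2]

theorem factorStart_length {S : List α} {L : List (List α)} (hL : IsLZ77 S L) :
    factorStart L L.length = S.length := by
  rw [hL.1]
  simp [factorStart]

/-- Every padded run occurs across the start of a factor or across the end of the string. -/
theorem IsPaddedRun.exists_boundary {dollar : α} {S : List α} {L : List (List α)}
    (hL : IsLZ77 S L) {k : ℕ} {w : List α} (h : IsPaddedRun dollar S k w) :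
    ∃ p l r i, 2 ^ k ≤ p ∧ p < 2 ^ (k + 1) ∧ IsRun dollar S p l r ∧
      w = substr dollar S (l - 1) r ∧ i ≤ L.length ∧ l ≤ factorStart L i + 1 ∧
      factorStart L i + 1 ≤ r := by
  classical
  have hex : ∃ l p r, 2 ^ k ≤ p ∧ p < 2 ^ (k + 1) ∧ IsRun dollar S p l r ∧
      w = substr dollar S (l - 1) r := by
    obtain ⟨p, l, r, h⟩ := h
    exact ⟨l, p, r, h⟩
  obtain ⟨p, r, hk, hk', hrun, hw⟩ := Nat.find_spec hex
  have hmin := fun m => Nat.find_min hex (m := m)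
  set l := Nat.find hex
  have h1 := hrun.one_le_left
  have h2 := hrun.right_le
  have h3 := hrun.length_ge
  have h4 := hrun.one_le_period
  by_contra hcon
  push Not at hcon
  have hb : ∀ i ≤ L.length, l ≤ factorStart L i + 1 → r < factorStart L i + 1 :=
    fun i hi hli => hcon p l r i hk hk' hrun hw hi hli
  have hbefore : ∀ i ≤ L.length, factorStart L i + 1 < l := by
    intro i
    induction i with
    | zero =>
      intro _
      by_contra hcc
      have := hb 0 (by omega) (by omega)
      simp [factorStart] at this
      omega
    | succ i ih =>
      intro hi
      have ih := ih (by omega)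
      by_contra hcc
      have hr := hb (i + 1) hi (by omega)
      have hs := factorStart_succ L (show i < L.length by omega)
      obtain ⟨d, hd1, hd2, hd3⟩ := hL.exists_earlier_copy dollar (show i < L.length by omega)
        (by omega)
      have hc : ∀ x, l - 1 ≤ x → x ≤ r → chr dollar S (x - d) = chr dollar S x :=
        fun x hx hx' => hd3 x (by omega) (by omega)
      refine hmin (l - d) (by omega) ⟨p, r - d, hk, hk', hrun.shift (by omega) hc, ?_⟩
      rw [hw]
      refine substr_eq_substr (by omega) fun j hj => ?_
      rw [← hc (l - 1 + j) (by omega) (by omega)]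
      congr 1
      omega
  have := hbefore L.length le_rfl
  rw [factorStart_length hL] at this
  omega

theorem IsRun.not_three_left {dollar : α} {S : List α} {t p₁ p₂ p₃ l₁ l₂ l₃ r₁ r₂ r₃ : ℕ}
    (h₁ : IsRun dollar S p₁ l₁ r₁) (h₂ : IsRun dollar S p₂ l₂ r₂)
    (h₃ : IsRun dollar S p₃ l₃ r₃) (h12 : p₁ < p₂) (h23 : p₂ < p₃) (h31 : p₃ < 2 * p₁)
    (hl₁ : l₁ + 2 * p₁ ≤ t) (hl₂ : l₂ + 2 * p₂ ≤ t) (hl₃ : l₃ + 2 * p₃ ≤ t)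
    (hr₁ : t ≤ r₁) (hr₂ : t ≤ r₂) (hr₃ : t ≤ r₃) : False := by
  have key : ∀ p l r, IsRun dollar S p l r → l + 2 * p ≤ t → t ≤ r →
      PeriodicOn (fun i => chr dollar S (t - 1 - i)) p 0 (2 * p) := by
    intro p l r h hl hr i _ hi
    have hl1 := h.one_le_left
    have := h.periodicOn (t - 1 - (i + p)) (by omega) (by omega)
    rw [show t - 1 - (i + p) + p = t - 1 - i by omega] at this
    exact this.symm
  obtain ⟨d, hd1, hd2, hd⟩ := exists_short_period_of_three_squares h12 h23 h31
    (key _ _ _ h₁ hl₁ hr₁) (key _ _ _ h₂ hl₂ hr₂) (key _ _ _ h₃ hl₃ hr₃)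
  have hl1 := h₁.one_le_left
  have hw : PeriodicOn (chr dollar S) d (t - 2 * p₁) t := by
    intro i hi hib
    have := hd (t - 1 - (i + d)) (by omega) (by omega)
    simp only at this
    rw [show t - 1 - (t - 1 - (i + d)) = i + d by omega,
      show t - 1 - (t - 1 - (i + d) + d) = i by omega] at this
    exact this.symm
  have := h₁.minimal d hd1
    (h₁.periodicOn.of_window h₁.one_le_period hw (by omega) hr₁ (by omega))
  omega

theorem IsRun.not_three_right {dollar : α} {S : List α} {t p₁ p₂ p₃ l₁ l₂ l₃ r₁ r₂ r₃ : ℕ}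
    (h₁ : IsRun dollar S p₁ l₁ r₁) (h₂ : IsRun dollar S p₂ l₂ r₂)
    (h₃ : IsRun dollar S p₃ l₃ r₃) (h12 : p₁ < p₂) (h23 : p₂ < p₃) (h31 : p₃ < 2 * p₁)
    (hr₁ : t + 2 * p₁ ≤ r₁) (hr₂ : t + 2 * p₂ ≤ r₂) (hr₃ : t + 2 * p₃ ≤ r₃)
    (hl₁ : l₁ ≤ t) (hl₂ : l₂ ≤ t) (hl₃ : l₃ ≤ t) : False := by
  have key : ∀ p l r, IsRun dollar S p l r → t + 2 * p ≤ r → l ≤ t →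
      PeriodicOn (fun i => chr dollar S (t + i)) p 0 (2 * p) := by
    intro p l r h hl hr i _ hi
    simpa only [add_assoc] using h.periodicOn (t + i) (by omega) (by omega)
  obtain ⟨d, hd1, hd2, hd⟩ := exists_short_period_of_three_squares h12 h23 h31
    (key _ _ _ h₁ hr₁ hl₁) (key _ _ _ h₂ hr₂ hl₂) (key _ _ _ h₃ hr₃ hl₃)
  have hw : PeriodicOn (chr dollar S) d t (t + 2 * p₁) := by
    intro i hi hib
    have := hd (i - t) (by omega) (by omega)
    simp only at this
    rw [show t + (i - t) = i by omega, show t + (i - t + d) = i + d by omega] at this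
    exact this
  have := h₁.minimal d hd1
    (h₁.periodicOn.of_window h₁.one_le_period hw hl₁ hr₁ (by omega))
  omega

/-- If equal keys force equal elements and no three keys are distinct, there are at most two
elements. -/
theorem Finset.card_le_two_of_keys {β : Type*} (s : Finset β) (key : β → ℕ → Prop)
    (hkey : ∀ a ∈ s, ∃ p, key a p)
    (hinj : ∀ a ∈ s, ∀ b ∈ s, ∀ p, key a p → key b p → a = b)
    (hthree : ∀ a b c p q r, key a p → key b q → key c r → p < q → q < r → False) :
    s.card ≤ 2 := by
  by_contra hcon
  obtain ⟨a, b, c, ha, hb, hc, hab, hac, hbc⟩ := Finset.two_lt_card_iff.1 (not_le.1 hcon)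
  obtain ⟨p, hp⟩ := hkey a ha
  obtain ⟨q, hq⟩ := hkey b hb
  obtain ⟨r, hr⟩ := hkey c hc
  have hpq : p ≠ q := fun e => hab (hinj a ha b hb p hp (e ▸ hq))
  have hpr : p ≠ r := fun e => hac (hinj a ha c hc p hp (e ▸ hr))
  have hqr : q ≠ r := fun e => hbc (hinj b hb c hc q hq (e ▸ hr))
  rcases lt_or_gt_of_ne hpq with h1 | h1 <;> rcases lt_or_gt_of_ne hpr with h2 | h2 <;>
    rcases lt_or_gt_of_ne hqr with h3 | h3
  · exact hthree _ _ _ _ _ _ hp hq hr h1 h3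
  · exact hthree _ _ _ _ _ _ hp hr hq h2 h3
  · omega
  · exact hthree _ _ _ _ _ _ hr hp hq h2 h1
  · exact hthree _ _ _ _ _ _ hq hp hr h1 h2
  · omega
  · exact hthree _ _ _ _ _ _ hq hr hp h3 h2
  · exact hthree _ _ _ _ _ _ hr hq hp h3 h1

/-- There are at most `4 (z + 1)` distinct padded runs of each scale. -/
theorem card_paddedRuns_le {dollar : α} {S : List α} {L : List (List α)} (hL : IsLZ77 S L)
    (k : ℕ) (U : Finset (List α)) (hU : ∀ w ∈ U, IsPaddedRun dollar S k w) :
    U.card ≤ 4 * (L.length + 1) := by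
  classical
  have hcode : ∀ w : List α, ∃ c : ℕ × Bool, w ∈ U → c.1 ≤ L.length ∧
      ∃ p l r, 2 ^ k ≤ p ∧ p < 2 ^ (k + 1) ∧ IsRun dollar S p l r ∧
        w = substr dollar S (l - 1) r ∧ l ≤ factorStart L c.1 + 1 ∧
        factorStart L c.1 + 1 ≤ r ∧
        if c.2 then l + 2 * p ≤ factorStart L c.1 + 1 else factorStart L c.1 + 1 + 2 * p ≤ r := by
    intro w
    by_cases hw : w ∈ U
    · obtain ⟨p, l, r, i, h1, h2, h3, h4, h5, h6, h7⟩ := (hU w hw).exists_boundary hL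
      have h8 := h3.length_ge
      by_cases hside : l + 2 * p ≤ factorStart L i + 1
      · exact ⟨(i, true), fun _ => ⟨h5, p, l, r, h1, h2, h3, h4, h6, h7, by simpa using hside⟩⟩
      · exact ⟨(i, false), fun _ => ⟨h5, p, l, r, h1, h2, h3, h4, h6, h7, by
          simp only [Bool.false_eq_true, if_false]
          omega⟩⟩
    · exact ⟨(0, true), fun h => absurd h hw⟩
  choose code hcode using hcode
  have hmaps : ∀ w ∈ U, code w ∈ Finset.range (L.length + 1) ×ˢ (Finset.univ : Finset Bool) := by
    intro w hw
    simpa using Nat.lt_succ_of_le (hcode w hw).1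
  have hfib : ∀ c ∈ Finset.range (L.length + 1) ×ˢ (Finset.univ : Finset Bool),
      (U.filter fun w => code w = c).card ≤ 2 := by
    rintro ⟨i, side⟩ -
    refine Finset.card_le_two_of_keys _ (fun w p => ∃ l r, 2 ^ k ≤ p ∧ p < 2 ^ (k + 1) ∧
      IsRun dollar S p l r ∧ w = substr dollar S (l - 1) r ∧ l ≤ factorStart L i + 1 ∧
      factorStart L i + 1 ≤ r ∧
      if side then l + 2 * p ≤ factorStart L i + 1 else factorStart L i + 1 + 2 * p ≤ r)
      ?_ ?_ ?_
    · intro w hw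
      obtain ⟨hwU, hwc⟩ := Finset.mem_filter.1 hw
      obtain ⟨-, p, l, r, h⟩ := hcode w hwU
      rw [hwc] at h
      exact ⟨p, l, r, h⟩
    · rintro a - b - p ⟨l, r, -, -, h3, h4, h5, h6, h7⟩ ⟨l', r', -, -, h3', h4', h5', h6', h7'⟩
      obtain ⟨rfl, rfl⟩ := h3.unique h3' (by cases side <;> simp at h7 h7' <;> omega)
        (by cases side <;> simp at h7 h7' <;> omega)
      rw [h4, h4']
    · rintro a b c p q r ⟨l₁, r₁, a1, a2, a3, -, a5, a6, a7⟩ ⟨l₂, r₂, b1, b2, b3, -, b5, b6, b7⟩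
        ⟨l₃, r₃, c1, c2, c3, -, c5, c6, c7⟩ hpq hqr
      rw [pow_succ] at a2 b2 c2
      cases side
      · simp only [Bool.false_eq_true, if_false] at a7 b7 c7
        exact a3.not_three_right b3 c3 hpq hqr (by omega) a7 b7 c7 a5 b5 c5
      · simp only [if_true] at a7 b7 c7
        exact a3.not_three_left b3 c3 hpq hqr (by omega) a7 b7 c7 a6 b6 c6
  have := Finset.card_le_mul_card_image_of_maps_to hmaps 2 hfib
  rw [Finset.card_product] at this
  simp at this
  omega

theorem exists_left_extension {dollar : α} {S : List α} (hS : dollar ∉ S) {p : ℕ} (hp : 1 ≤ p) :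
    ∀ n, 1 ≤ n → n + p ≤ S.length + 1 → ∃ l, 1 ≤ l ∧ l ≤ n ∧
      (∀ i, l ≤ i → i < n → chr dollar S i = chr dollar S (i + p)) ∧
      chr dollar S (l - 1) ≠ chr dollar S (l - 1 + p) := by
  intro n hn
  induction n, hn using Nat.le_induction with
  | base =>
    intro h
    refine ⟨1, le_rfl, le_rfl, fun i _ _ => by omega, ?_⟩
    rw [chr_eq_dollar dollar S (i := 1 - 1) (by omega)]
    exact (chr_ne_dollar hS (by omega) (by omega)).symm
  | succ n hn ih =>
    intro h
    by_cases he : chr dollar S n = chr dollar S (n + p)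
    · obtain ⟨l, h1, h2, h3, h4⟩ := ih (by omega)
      refine ⟨l, h1, by omega, fun i hi hi' => ?_, h4⟩
      rcases Nat.lt_succ_iff_lt_or_eq.1 hi' with h | rfl
      · exact h3 i hi h
      · exact he
    · exact ⟨n + 1, by omega, le_rfl, fun i _ _ => by omega, by simpa using he⟩

theorem exists_right_extension {dollar : α} {S : List α} (hS : dollar ∉ S) {p : ℕ}
    (hp : 1 ≤ p) : ∀ (s m : ℕ), m + s = S.length + 1 → p + 1 ≤ m → ∃ r, m ≤ r ∧
      r ≤ S.length + 1 ∧ (∀ i, m ≤ i → i < r → chr dollar S i = chr dollar S (i - p)) ∧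
      chr dollar S r ≠ chr dollar S (r - p) := by
  intro s
  induction s with
  | zero =>
    intro m hm hpm
    refine ⟨m, le_rfl, by omega, fun i _ _ => by omega, ?_⟩
    rw [chr_eq_dollar dollar S (i := m) (by omega)]
    exact (chr_ne_dollar hS (by omega) (by omega)).symm
  | succ s ih =>
    intro m hm hpm
    by_cases he : chr dollar S m = chr dollar S (m - p)
    · obtain ⟨r, h1, h2, h3, h4⟩ := ih (m + 1) (by omega) (by omega)
      refine ⟨r, by omega, h2, fun i hi hi' => ?_, h4⟩
      rcases Nat.eq_or_lt_of_le hi with rfl | h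
      · exact he
      · exact h3 i h hi'
    · exact ⟨m, le_rfl, by omega, fun i _ _ => by omega, he⟩

/-- Every occurrence of a fractional power with exponent at least `4` lies in a run. -/
theorem exists_isRun {dollar : α} {S : List α} (hS : dollar ∉ S) {p n l : ℕ} (hp : 1 ≤ p)
    (hn : 1 ≤ n) (hnl : n + l ≤ S.length + 1) (h4 : 4 * p ≤ l)
    (hper : PeriodicOn (chr dollar S) p n (n + l))
    (hmin : ∀ d, 1 ≤ d → PeriodicOn (chr dollar S) d n (n + l) → p ≤ d) :
    ∃ a b, IsRun dollar S p a b ∧ a ≤ n ∧ n + l ≤ b := by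
  obtain ⟨a, a1, a2, a3, a4⟩ := exists_left_extension hS hp n hn (by omega)
  obtain ⟨b, b1, b2, b3, b4⟩ := exists_right_extension hS hp (S.length + 1 - (n + l)) (n + l)
    (by omega) (by omega)
  refine ⟨a, b, ⟨hp, a1, b2, by omega, ?_, fun d hd h => hmin d hd (h.mono a2 b1), a4, b4⟩,
    a2, b1⟩
  intro i hi hib
  by_cases h1 : i < n
  · exact a3 i hi h1
  · by_cases h2 : i + p < n + l
    · exact hper i (by omega) h2
    · have := b3 (i + p) (by omega) hib
      rw [this]
      congr 1
      omega

/-- The smallest period of a padded string `w` without its first and last character. -/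
noncomputable def corePeriod (dollar : α) (w : List α) : ℕ :=
  sInf {d | 1 ≤ d ∧ ∀ j, 1 ≤ j → j + d + 1 < w.length → w.getD j dollar = w.getD (j + d) dollar}

/-- Replace the first and last character of `w` by those continuing the period of its core. -/
noncomputable def continueEnds (dollar : α) (w : List α) : List α :=
  (List.range w.length).map fun j =>
    if j = 0 then w.getD (corePeriod dollar w) dollar
    else if j + 1 = w.length then w.getD (j - corePeriod dollar w) dollar
    else w.getD j dollar

open Classical in
/-- The padded occurrences of a pair of which one occurrence is a whole run, decoded from two
padded runs. -/
noncomputable def decodePair (dollar : α) (R R' : List α) : Set (List α) :=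
  if R = R' then {R, continueEnds dollar R}
  else if R.length ≤ R'.length then {R, R'.take R.length}
  else {R', R.drop (R.length - R'.length)}

/-- `s` consists of the padded occurrences of a string that is both a proper prefix of the run
`R` and a proper suffix of the run `R'`, one of which is extendable by at most one period. -/
def IsPrefixSuffixPair (dollar : α) (R R' : List α) (s : Set (List α)) : Prop :=
  ∃ c, s = {R.take c, R'.drop (R'.length - c)} ∧ c < R.length ∧ c < R'.length ∧
    (R.length ≤ c + corePeriod dollar R ∨ R'.length ≤ c + corePeriod dollar R) ∧
    (∀ j, 1 ≤ j → j + 1 < c → R.getD j dollar = R'.getD (R'.length - c + j) dollar) ∧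
    (∀ d, 1 ≤ d → (∀ j, 1 ≤ j → j + d + 1 < c → R.getD j dollar = R.getD (j + d) dollar) →
      corePeriod dollar R ≤ d)

theorem IsPrefixSuffixPair.length_unique {dollar : α} {R R' : List α} {c c' : ℕ}
    (hlt : c < c') (h1 : c' < R.length) (h2 : c' < R'.length)
    (h3 : R.length ≤ c + corePeriod dollar R ∨ R'.length ≤ c + corePeriod dollar R)
    (h : ∀ j, 1 ≤ j → j + 1 < c → R.getD j dollar = R'.getD (R'.length - c + j) dollar)
    (h' : ∀ j, 1 ≤ j → j + 1 < c' → R.getD j dollar = R'.getD (R'.length - c' + j) dollar)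
    (hmin : ∀ d, 1 ≤ d →
      (∀ j, 1 ≤ j → j + d + 1 < c' → R.getD j dollar = R.getD (j + d) dollar) →
      corePeriod dollar R ≤ d) : False := by
  have := hmin (c' - c) (by omega) fun j hj hj' => by
    rw [h j hj (by omega), h' (j + (c' - c)) (by omega) (by omega)]
    congr 1
    omega
  omega

theorem IsPrefixSuffixPair.unique {dollar : α} {R R' : List α} {s s' : Set (List α)}
    (h : IsPrefixSuffixPair dollar R R' s) (h' : IsPrefixSuffixPair dollar R R' s') :
    s = s' := by
  obtain ⟨c, hs, h1, h2, h3, h4, h5⟩ := h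
  obtain ⟨c', hs', h1', h2', h3', h4', h5'⟩ := h'
  rcases lt_trichotomy c c' with hlt | heq | hlt
  · exact (length_unique hlt h1' h2' h3 h4 h4' h5').elim
  · rw [hs, hs', heq]
  · exact (length_unique hlt h1 h2 h3' h4' h4 h5).elim

/-- The set `s` of two padded occurrences is encoded by a bit and two padded runs. -/
def Encodes (dollar : α) (b : Bool) (R R' : List α) (s : Set (List α)) : Prop :=
  if b then s = decodePair dollar R R' else IsPrefixSuffixPair dollar R R' s

theorem Encodes.unique {dollar : α} {b : Bool} {R R' : List α} {s s' : Set (List α)}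
    (h : Encodes dollar b R R' s) (h' : Encodes dollar b R R' s') : s = s' := by
  cases b
  · simp only [Encodes, Bool.false_eq_true, if_false] at h h'
    exact h.unique h'
  · simp only [Encodes, if_true] at h h'
    rw [h, h']

theorem corePeriod_substr {dollar : α} {S : List α} {p l r : ℕ} (h : IsRun dollar S p l r) :
    corePeriod dollar (substr dollar S (l - 1) r) = p := by
  have h1 := h.one_le_left
  have h4 := h.length_ge
  refine IsLeast.csInf_eq ⟨⟨h.one_le_period, fun j hj hj' => ?_⟩, fun d ⟨hd, hd'⟩ => ?_⟩
  · rw [length_substr] at hj'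
    rw [getD_substr dollar S (by omega), getD_substr dollar S (by omega), ← add_assoc]
    exact h.periodicOn _ (by omega) (by omega)
  · refine h.minimal d hd fun i hi hib => ?_
    have := hd' (i - (l - 1)) (by omega) (by rw [length_substr]; omega)
    rw [getD_substr dollar S (by omega), getD_substr dollar S (by omega)] at this
    rw [show l - 1 + (i - (l - 1)) = i by omega,
      show l - 1 + (i - (l - 1) + d) = i + d by omega] at this
    exact this

theorem take_substr (dollar : α) (S : List α) {a b b' : ℕ} (h : b' ≤ b) (c : ℕ)
    (hc : c = b' + 1 - a) : (substr dollar S a b).take c = substr dollar S a b' := by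
  subst hc
  apply List.ext_getElem
  · simp; omega
  · intro k _ _
    simp

theorem drop_substr (dollar : α) (S : List α) {a a' b : ℕ} (h : a ≤ a') (c : ℕ)
    (hc : c = a' - a) : (substr dollar S a b).drop c = substr dollar S a' b := by
  subst hc
  apply List.ext_getElem
  · simp; omega
  · intro k _ _
    simp only [List.getElem_drop, getElem_substr]
    congr 1
    omega

/-- Two occurrences of the same string with smallest period `p` and exponent at least `4`, with
different characters on both sides, each contained in a run. -/
structure RunPair (dollar : α) (S : List α) (p n m l a b a' b' : ℕ) : Prop where
  run_left : IsRun dollar S p a b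
  run_right : IsRun dollar S p a' b'
  le_left : a ≤ n
  le_left' : a' ≤ m
  right_le : n + l ≤ b
  right_le' : m + l ≤ b'
  length_ge : 4 * p ≤ l
  minimal : ∀ d, 1 ≤ d → PeriodicOn (chr dollar S) d n (n + l) → p ≤ d
  minimal' : ∀ d, 1 ≤ d → PeriodicOn (chr dollar S) d m (m + l) → p ≤ d
  eq : ∀ k, k < l → chr dollar S (n + k) = chr dollar S (m + k)
  left_ne : chr dollar S (n - 1) ≠ chr dollar S (m - 1)
  right_ne : chr dollar S (n + l) ≠ chr dollar S (m + l)
  short : b ≤ a + l + p ∨ b' ≤ a' + l + p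

section RunPair

variable {dollar : α} {S : List α} {p n m l a b a' b' : ℕ}

theorem RunPair.symm (h : RunPair dollar S p n m l a b a' b') :
    RunPair dollar S p m n l a' b' a b :=
  ⟨h.run_right, h.run_left, h.le_left', h.le_left, h.right_le', h.right_le, h.length_ge,
    h.minimal', h.minimal, fun k hk => (h.eq k hk).symm, h.left_ne.symm, h.right_ne.symm,
    h.short.symm⟩

theorem RunPair.left_break (h : RunPair dollar S p n m l a b a' b') : n = a ∨ m = a' := by
  have h1 := h.le_left
  have h2 := h.le_left'
  have h3 := h.run_left.one_le_left
  have h4 := h.run_right.one_le_left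
  have h5 := h.length_ge
  have h6 := h.right_le
  have h7 := h.right_le'
  have h8 := h.run_left.one_le_period
  by_contra hc
  push Not at hc
  apply h.left_ne
  rw [h.run_left.periodicOn (n - 1) (by omega) (by omega),
    h.run_right.periodicOn (m - 1) (by omega) (by omega),
    show n - 1 + p = n + (p - 1) by omega, show m - 1 + p = m + (p - 1) by omega]
  exact h.eq _ (by omega)

theorem RunPair.right_break (h : RunPair dollar S p n m l a b a' b') :
    n + l = b ∨ m + l = b' := by
  have h1 := h.le_left
  have h2 := h.le_left'
  have h5 := h.length_ge
  have h6 := h.right_le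
  have h7 := h.right_le'
  have h8 := h.run_left.one_le_period
  by_contra hc
  push Not at hc
  apply h.right_ne
  have e1 := h.run_left.periodicOn (n + (l - p)) (by omega) (by omega)
  have e2 := h.run_right.periodicOn (m + (l - p)) (by omega) (by omega)
  rw [show n + (l - p) + p = n + l by omega] at e1
  rw [show m + (l - p) + p = m + l by omega] at e2
  rw [← e1, ← e2]
  exact h.eq _ (by omega)

theorem RunPair.encodes_prefix_suffix (h : RunPair dollar S p n m l a b a' b') (hn : n = a)
    (hm : m + l = b') (hb : n + l < b) (ha : a' < m) :
    Encodes dollar false (substr dollar S (a - 1) b) (substr dollar S (a' - 1) b')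
      {substr dollar S (n - 1) (n + l), substr dollar S (m - 1) (m + l)} := by
  have h3 := h.run_left.one_le_left
  have h4 := h.run_right.one_le_left
  have h5 := h.length_ge
  have h8 := h.run_left.one_le_period
  have h9 := h.short
  subst hn hm
  simp only [Encodes, Bool.false_eq_true, if_false]
  refine ⟨l + 2, ?_, by simp; omega, by simp; omega, ?_, ?_, ?_⟩
  · rw [take_substr dollar S (b' := n + l) (by omega) _ (by omega),
      drop_substr dollar S (a' := m - 1) (by omega) _ (by simp; omega)]
  · rw [corePeriod_substr h.run_left]
    simp
    omega
  · intro j hj hj'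
    rw [getD_substr dollar S (by omega), getD_substr dollar S (by simp; omega), length_substr,
      show n - 1 + j = n + (j - 1) by omega,
      show a' - 1 + (m + l + 1 - (a' - 1) - (l + 2) + j) = m + (j - 1) by omega]
    exact h.eq _ (by omega)
  · intro d hd hper
    rw [corePeriod_substr h.run_left]
    refine h.minimal d hd fun i hi hib => ?_
    have := hper (i - (n - 1)) (by omega) (by omega)
    rw [getD_substr dollar S (by omega), getD_substr dollar S (by omega),
      show n - 1 + (i - (n - 1)) = i by omega,
      show n - 1 + (i - (n - 1) + d) = i + d by omega] at this
    exact this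

theorem RunPair.continueEnds_eq (h : RunPair dollar S p n m l a b a' b') (hn : n = a)
    (hb : n + l = b) (hm : a' < m) (hb' : m + l < b') :
    continueEnds dollar (substr dollar S (a - 1) b) = substr dollar S (m - 1) (m + l) := by
  have h3 := h.run_left.one_le_left
  have h4 := h.run_right.one_le_left
  have h5 := h.length_ge
  have h8 := h.run_left.one_le_period
  subst hn hb
  apply List.ext_getElem
  · simp [continueEnds]; omega
  · intro j hj hj'
    simp only [continueEnds, List.length_map, List.length_range, length_substr] at hj hj'
    simp only [continueEnds, List.getElem_map, List.getElem_range,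
      corePeriod_substr h.run_left, length_substr, getElem_substr]
    split_ifs with hj0 hj1
    · rw [getD_substr dollar S (by omega), hj0,
        h.run_right.periodicOn (m - 1 + 0) (by omega) (by omega),
        show n - 1 + p = n + (p - 1) by omega, show m - 1 + 0 + p = m + (p - 1) by omega]
      exact h.eq _ (by omega)
    · have e := h.run_right.periodicOn (m + (l - p)) (by omega) (by omega)
      rw [getD_substr dollar S (by omega), show m - 1 + j = m + (l - p) + p by omega, ← e,
        show n - 1 + (j - p) = n + (l - p) by omega]
      exact h.eq _ (by omega)
    · rw [getD_substr dollar S (by omega), show n - 1 + j = n + (j - 1) by omega,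
        show m - 1 + j = m + (j - 1) by omega]
      exact h.eq _ (by omega)

theorem RunPair.encodes_whole_run (h : RunPair dollar S p n m l a b a' b') (hn : n = a)
    (hb : n + l = b) :
    ∃ R R', (R = substr dollar S (a - 1) b ∨ R = substr dollar S (a' - 1) b') ∧
      (R' = substr dollar S (a - 1) b ∨ R' = substr dollar S (a' - 1) b') ∧
      Encodes dollar true R R'
        {substr dollar S (n - 1) (n + l), substr dollar S (m - 1) (m + l)} := by
  have h1 := h.le_left'
  have h2 := h.right_le'
  have h3 := h.run_left.one_le_left
  have h4 := h.run_right.one_le_left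
  have h5 := h.length_ge
  have h8 := h.run_left.one_le_period
  simp only [Encodes, if_true]
  by_cases hm : m = a'
  · refine ⟨_, _, Or.inl rfl, Or.inr rfl, ?_⟩
    subst hn hb hm
    have hne : substr dollar S (n - 1) (n + l) ≠ substr dollar S (m - 1) b' := by
      intro e
      apply h.left_ne
      have := congrArg (fun w => w.getD 0 dollar) e
      rw [getD_substr dollar S (by omega), getD_substr dollar S (by omega)] at this
      simpa using this
    rw [decodePair, if_neg hne, if_pos (by simp; omega),
      take_substr dollar S (b' := m + l) (by omega) _ (by simp; omega)]
  · by_cases hb' : m + l = b'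
    · refine ⟨_, _, Or.inr rfl, Or.inl rfl, ?_⟩
      subst hn hb hb'
      have hlen : ¬ (substr dollar S (a' - 1) (m + l)).length ≤
          (substr dollar S (n - 1) (n + l)).length := by
        simp; omega
      rw [decodePair, if_neg (fun e => hlen (by rw [e])), if_neg hlen,
        drop_substr dollar S (a' := m - 1) (by omega) _ (by simp; omega)]
    · refine ⟨_, _, Or.inl rfl, Or.inl rfl, ?_⟩
      rw [decodePair, if_pos rfl, h.continueEnds_eq hn hb (by omega) (by omega), hn]
      subst hn hb
      rfl

theorem RunPair.encodes (h : RunPair dollar S p n m l a b a' b') :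
    ∃ c R R', (R = substr dollar S (a - 1) b ∨ R = substr dollar S (a' - 1) b') ∧
      (R' = substr dollar S (a - 1) b ∨ R' = substr dollar S (a' - 1) b') ∧
      Encodes dollar c R R'
        {substr dollar S (n - 1) (n + l), substr dollar S (m - 1) (m + l)} := by
  have h1 := h.le_left
  have h2 := h.le_left'
  have h3 := h.right_le
  have h4 := h.right_le'
  by_cases hw : n = a ∧ n + l = b
  · exact ⟨true, h.encodes_whole_run hw.1 hw.2⟩
  by_cases hw' : m = a' ∧ m + l = b'
  · obtain ⟨R, R', hR, hR', he⟩ := h.symm.encodes_whole_run hw'.1 hw'.2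
    exact ⟨true, R, R', hR.symm, hR'.symm, by rwa [Set.pair_comm]⟩
  have h5 := h.left_break
  have h6 := h.right_break
  by_cases hn : n = a
  · exact ⟨false, _, _, Or.inl rfl, Or.inr rfl,
      h.encodes_prefix_suffix hn (by omega) (by omega) (by omega)⟩
  · refine ⟨false, _, _, Or.inr rfl, Or.inl rfl, ?_⟩
    rw [Set.pair_comm]
    exact h.symm.encodes_prefix_suffix (by omega) (by omega) (by omega) (by omega)

theorem run_of_shortExt (hn : 1 ≤ n) (hl : 1 ≤ l) (hrun : IsRun dollar S p a b) (ha : a ≤ n)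
    (hb : n + l ≤ b) (h4 : 4 * p ≤ l)
    (hmin : ∀ d, 1 ≤ d → PeriodicOn (chr dollar S) d n (n + l) → p ≤ d)
    (hp : minPeriod (substr dollar S n (n + l - 1)) = p)
    (h : ShortExt dollar S n (n + l - 1)) : b ≤ a + l + p := by
  obtain ⟨l', r', ⟨h1, h2, h3, h4', h5, h6, h7, h8, h9⟩, hs⟩ := h
  rw [hp] at h6 h7 h8 h9 hs
  rw [isPeriodOf_substr] at h7 h8 h9
  obtain ⟨hp1, h7⟩ := h7
  have hrun' : IsRun dollar S p l' (r' + 1) := by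
    refine ⟨hp1, h1, by omega, by omega, h7,
      fun d hd hper => hmin d hd (hper.mono h2 (by omega)), ?_, ?_⟩
    · intro e
      refine h8 ⟨hp1, fun i hi hib => ?_⟩
      rcases Nat.eq_or_lt_of_le hi with rfl | hlt
      · exact e
      · exact h7 i (by omega) hib
    · intro e
      refine h9 ⟨hp1, fun i hi hib => ?_⟩
      by_cases hi' : i + p = r' + 1
      · rw [hi', e]
        congr 1
        omega
      · exact h7 i hi (by omega)
  obtain ⟨rfl, rfl⟩ := hrun.unique hrun' (by omega) (by omega)
  omega

/-- The scale, bit and padded runs encoding a maximal pair of highly periodic occurrences. -/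
theorem exists_encoding (hS : dollar ∉ S) (hpair : IsMaximalPair dollar S n m l)
    (hpow : IsFracPowGe 4 (substr dollar S n (n + l - 1)))
    (hshort : ShortExt dollar S n (n + l - 1) ∨ ShortExt dollar S m (m + l - 1)) :
    ∃ (k : ℕ) (c : Bool) (R R' : List α), k < Nat.log 2 S.length ∧
      IsPaddedRun dollar S k R ∧ IsPaddedRun dollar S k R' ∧
      Encodes dollar c R R'
        {substr dollar S (n - 1) (n + l), substr dollar S (m - 1) (m + l)} := by
  obtain ⟨hl, hn, hm, hnl, hml, heq, hne, hne'⟩ := hpair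
  have hsub : substr dollar S n (n + l - 1) = substr dollar S m (m + l - 1) :=
    substr_eq_substr (by omega) fun k hk => heq k (by omega)
  obtain ⟨p, hp⟩ : ∃ p, minPeriod (substr dollar S n (n + l - 1)) = p := ⟨_, rfl⟩
  have hp' : minPeriod (substr dollar S m (m + l - 1)) = p := by rw [← hsub, hp]
  have key : ∀ n, 1 ≤ n → n + l - 1 ≤ S.length →
      minPeriod (substr dollar S n (n + l - 1)) = p → 1 ≤ p ∧
      PeriodicOn (chr dollar S) p n (n + l) ∧
      ∀ d, 1 ≤ d → PeriodicOn (chr dollar S) d n (n + l) → p ≤ d := by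
    intro n hn hnl hp
    have h1 := isPeriodOf_minPeriod (substr dollar S n (n + l - 1))
    rw [hp, isPeriodOf_substr, show n + l - 1 + 1 = n + l by omega] at h1
    refine ⟨h1.1, h1.2, fun d hd hper => ?_⟩
    rw [← hp]
    apply minPeriod_le
    rw [isPeriodOf_substr, show n + l - 1 + 1 = n + l by omega]
    exact ⟨hd, hper⟩
  obtain ⟨hp1, hper, hmin⟩ := key n hn hnl hp
  obtain ⟨-, hper', hmin'⟩ := key m hm hml hp'
  have h4 : 4 * p ≤ l := by
    rw [IsFracPowGe, hp, length_substr] at hpow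
    omega
  obtain ⟨a, b, hrun, ha, hb⟩ := exists_isRun hS hp1 hn (by omega) h4 hper hmin
  obtain ⟨a', b', hrun', ha', hb'⟩ := exists_isRun hS hp1 hm (by omega) h4 hper' hmin'
  have hRP : RunPair dollar S p n m l a b a' b' :=
    ⟨hrun, hrun', ha, ha', hb, hb', h4, hmin, hmin', heq, hne, hne',
      hshort.imp (run_of_shortExt hn hl hrun ha hb h4 hmin hp)
        (run_of_shortExt hm hl hrun' ha' hb' h4 hmin' hp')⟩
  obtain ⟨c, R, R', hR, hR', henc⟩ := hRP.encodes
  have hk1 : 2 ^ Nat.log 2 p ≤ p := Nat.pow_log_le_self 2 (by omega)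
  have hk2 : p < 2 ^ (Nat.log 2 p + 1) := Nat.lt_pow_succ_log_self (by omega) p
  have hpad : ∀ w, w = substr dollar S (a - 1) b ∨ w = substr dollar S (a' - 1) b' →
      IsPaddedRun dollar S (Nat.log 2 p) w := by
    rintro w (rfl | rfl)
    · exact ⟨p, a, b, hk1, hk2, hrun, rfl⟩
    · exact ⟨p, a', b', hk1, hk2, hrun', rfl⟩
  refine ⟨Nat.log 2 p, c, R, R', ?_, hpad R hR, hpad R' hR', henc⟩
  have hle : 2 ^ (Nat.log 2 p + 1) ≤ S.length := by
    rw [pow_succ]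
    omega
  exact Nat.le_log_of_pow_le (by omega) hle

end RunPair

/-- If `S` has `z` LZ77-factors, then there are at most
`32·(z+1)²·log₂|S|` pairwise substantially different maximal pairs whose two positioned
occurrences are fractional powers with exponent `≥ 4` of which at least one is periodically
extendable by at most one period length. -/
theorem highly_periodic_maximal_pairs_bound (dollar : α) (S : List α)
    (hdollar : dollar ∉ S)
    (L : List (List α)) (z : ℕ) (hL : IsLZ77 S L) (hz : L.length = z)
    (M : Finset (ℕ × ℕ × ℕ))
    (hM : ∀ p ∈ M, IsMaximalPair dollar S p.1 p.2.1 p.2.2 ∧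
      IsFracPowGe 4 (substr dollar S p.1 (p.1 + p.2.2 - 1)) ∧
      IsFracPowGe 4 (substr dollar S p.2.1 (p.2.1 + p.2.2 - 1)) ∧
      (ShortExt dollar S p.1 (p.1 + p.2.2 - 1) ∨ ShortExt dollar S p.2.1 (p.2.1 + p.2.2 - 1)))
    (hdiff : ∀ p ∈ M, ∀ p' ∈ M, p ≠ p' → ¬ CopiesMP dollar S p p') :
    (M.card : ℝ) ≤ 32 * ((z : ℝ) + 1) ^ 2 * Real.logb 2 (S.length : ℝ) := by
  classical
  have hcode : ∀ p : ℕ × ℕ × ℕ, ∃ c : ℕ × Bool × List α × List α, p ∈ M →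
      c.1 < Nat.log 2 S.length ∧ IsPaddedRun dollar S c.1 c.2.2.1 ∧
      IsPaddedRun dollar S c.1 c.2.2.2 ∧ Encodes dollar c.2.1 c.2.2.1 c.2.2.2
        {substr dollar S (p.1 - 1) (p.1 + p.2.2), substr dollar S (p.2.1 - 1) (p.2.1 + p.2.2)} := by
    intro p
    by_cases hp : p ∈ M
    · obtain ⟨h1, h2, -, h3⟩ := hM p hp
      obtain ⟨k, c, R, R', h⟩ := exists_encoding hdollar h1 h2 h3
      exact ⟨(k, c, R, R'), fun _ => h⟩
    · exact ⟨(0, true, [], []), fun h => absurd h hp⟩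
  choose code hcode using hcode
  have hmaps : ∀ p ∈ M, (code p).1 ∈ Finset.range (Nat.log 2 S.length) :=
    fun p hp => Finset.mem_range.2 (hcode p hp).1
  have hfib : ∀ k ∈ Finset.range (Nat.log 2 S.length),
      (M.filter fun p => (code p).1 = k).card ≤ 32 * (z + 1) ^ 2 := by
    intro k _
    set N := M.filter fun p => (code p).1 = k
    set U := N.image (fun p => (code p).2.2.1) ∪ N.image (fun p => (code p).2.2.2)
    have hUcard : U.card ≤ 4 * (z + 1) := by
      rw [← hz]
      refine card_paddedRuns_le (dollar := dollar) hL k U fun w hw => ?_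
      rcases Finset.mem_union.1 hw with h | h <;>
      · obtain ⟨p, hp, rfl⟩ := Finset.mem_image.1 h
        obtain ⟨hpM, rfl⟩ := Finset.mem_filter.1 hp
        first
        | exact (hcode p hpM).2.1
        | exact (hcode p hpM).2.2.1
    have hinj : N.card ≤ ((Finset.univ : Finset Bool) ×ˢ U ×ˢ U).card := by
      refine Finset.card_le_card_of_injOn (fun p => (code p).2) ?_ ?_
      · intro p hp
        have hp' : p ∈ N := hp
        simp only [Finset.coe_product, Set.mem_prod, Finset.mem_coe]
        exact ⟨Finset.mem_univ _,
          Finset.mem_union_left _ (Finset.mem_image_of_mem _ hp'),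
          Finset.mem_union_right _ (Finset.mem_image_of_mem _ hp')⟩
      · intro p hp q hq hpq
        obtain ⟨hpM, hpk⟩ := Finset.mem_filter.1 (Finset.mem_coe.1 hp)
        obtain ⟨hqM, hqk⟩ := Finset.mem_filter.1 (Finset.mem_coe.1 hq)
        by_contra hne
        have h1 := (hcode p hpM).2.2.2
        have h2 := (hcode q hqM).2.2.2
        simp only at hpq
        rw [← hpq] at h2
        exact hdiff p hpM q hqM hne (h1.unique h2)
    rw [Finset.card_product, Finset.card_product, Finset.card_univ, Fintype.card_bool] at hinj
    nlinarith [Nat.mul_le_mul hUcard hUcard]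
  have hcard := Finset.card_le_mul_card_image_of_maps_to hmaps _ hfib
  rw [Finset.card_range] at hcard
  calc (M.card : ℝ) ≤ ((32 * (z + 1) ^ 2 * Nat.log 2 S.length : ℕ) : ℝ) := by exact_mod_cast hcard
    _ = 32 * ((z : ℝ) + 1) ^ 2 * (Nat.log 2 S.length : ℝ) := by push_cast; ring
    _ ≤ 32 * ((z : ℝ) + 1) ^ 2 * Real.logb 2 (S.length : ℝ) := by
      have := Real.natLog_le_logb S.length 2
      gcongr
      exact_mod_cast this
end
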